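/- Let j(τ) be a singular modulus of discriminant Δ. Then the set of roots in ℂ of the minimal polynomial of j(τ) over ℚ is exactly { j((−b + √Δ)/(2a)) : (a,b,c) ∈ T_Δ }, these values are pairwise distinct, and consequently the degree of j(τ) over ℚ equals the cardinality of T_Δ. -/

import Mathlib

/-- The Eisenstein-series quantity `g₂(τ) = 60 ∑' 1/(m+nτ)⁴` (junk value off `ℍ`). -/
noncomputable def g2 (τ : ℂ) : ℂ :=
  60 * ∑' p : ℤ × ℤ, if p = 0 then 0 else (((p.1 : ℂ) + (p.2 : ℂ) * τ) ^ 4)⁻¹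

/-- The Eisenstein-series quantity `g₃(τ) = 140 ∑' 1/(m+nτ)⁶` (junk value off `ℍ`). -/
noncomputable def g3 (τ : ℂ) : ℂ :=
  140 * ∑' p : ℤ × ℤ, if p = 0 then 0 else (((p.1 : ℂ) + (p.2 : ℂ) * τ) ^ 6)⁻¹

/-- Klein's modular `j`-invariant `j = 1728 g₂³ / (g₂³ - 27 g₃²)`. -/
noncomputable def klein (τ : ℂ) : ℂ :=
  1728 * g2 τ ^ 3 / (g2 τ ^ 3 - 27 * g3 τ ^ 2)

/-- `x` is a singular modulus of discriminant `Δ`: `x = j(τ)` where `τ` lies in the upper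
half-plane and is a root of a primitive integer quadratic `aX² + bX + c` (with `a > 0`) of
discriminant `Δ = b² - 4ac`. -/
def IsSingularModulus (x : ℂ) (Δ : ℤ) : Prop :=
  ∃ τ : ℂ, 0 < τ.im ∧
    (∃ a b c : ℤ, 0 < a ∧ Int.gcd a (Int.gcd b c) = 1 ∧
      (a : ℂ) * τ ^ 2 + (b : ℂ) * τ + (c : ℂ) = 0 ∧ Δ = b ^ 2 - 4 * a * c) ∧
    x = klein τ

/-- The set `T_Δ` of reduced primitive integer triples `(a,b,c)` with `Δ = b² - 4ac` and
either `-a < b ≤ a < c` or `0 ≤ b ≤ a = c`. -/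
def Tset (Δ : ℤ) : Set (ℤ × ℤ × ℤ) :=
  {t | Int.gcd t.1 (Int.gcd t.2.1 t.2.2) = 1 ∧ Δ = t.2.1 ^ 2 - 4 * t.1 * t.2.2 ∧
    ((-t.1 < t.2.1 ∧ t.2.1 ≤ t.1 ∧ t.1 < t.2.2) ∨ (0 ≤ t.2.1 ∧ t.2.1 ≤ t.1 ∧ t.1 = t.2.2))}

/-- For `Δ < 0`, the square root of `Δ` with positive imaginary part: `√Δ = i·√(-Δ)`. -/
noncomputable def sqrtD (Δ : ℤ) : ℂ := Complex.I * Real.sqrt (-(Δ : ℝ))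

section JFunction

open UpperHalfPlane ModularForm EisensteinSeries MatrixGroups CongruenceSubgroup
open scoped Manifold

lemma tsum_lattice_inv_pow_eq {k : ℕ} (hk : 3 ≤ k) (z : ℍ) :
    ∑' p : ℤ × ℤ, (((p.1 : ℂ) + (p.2 : ℂ) * z) ^ k)⁻¹ = 2 * riemannZeta k * E hk z := by
  have h1 := tsum_eisSummand_eq_riemannZeta_mul_eisensteinSeries hk z
  have h2 : E hk z = (1 / 2 : ℂ) * eisensteinSeries (N := 1) 0 k z := rfl
  rw [h2, ← (finTwoArrowEquiv ℤ).symm.tsum_eq, finTwoArrowEquiv_symm_apply] at *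
  rw [← (Equiv.prodComm ℤ ℤ).tsum_eq]
  trans riemannZeta k * eisensteinSeries (N := 1) 0 k z
  · rw [← h1]
    refine tsum_congr fun p => ?_
    simp [eisSummand, add_comm]
  · ring

lemma g2_coe (z : ℍ) : g2 z = 4 / 3 * Real.pi ^ 4 * E₄ z := by
  have h := tsum_lattice_inv_pow_eq (by norm_num : 3 ≤ 4) z
  have : g2 z = 60 * ∑' p : ℤ × ℤ, (((p.1 : ℂ) + (p.2 : ℂ) * z) ^ 4)⁻¹ := by
    unfold g2
    congr 1
    refine tsum_congr fun p => ?_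
    split_ifs with hp
    · simp [hp]
    · rfl
  rw [this, h]
  have := riemannZeta_four
  push_cast
  rw [this]
  ring

lemma riemannZeta_six : riemannZeta 6 = (Real.pi : ℂ) ^ 6 / 945 := by
  have h := riemannZeta_two_mul_nat (k := 3) (by norm_num)
  have hb : bernoulli 6 = 1 / 42 := by
    rw [bernoulli_eq_bernoulli'_of_ne_one (by norm_num)]
    rw [bernoulli'_def]
    have e5 : bernoulli' 5 = 0 := bernoulli'_eq_zero_of_odd (by decide) (by norm_num)
    simp [Finset.sum_range_succ, bernoulli'_zero, bernoulli'_one, bernoulli'_two, bernoulli'_three,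
      bernoulli'_four, e5]
    norm_num [Nat.choose]
  norm_num [hb, Nat.factorial] at h
  rw [h]; ring

lemma g3_coe (z : ℍ) : g3 z = 8 / 27 * Real.pi ^ 6 * E₆ z := by
  have h := tsum_lattice_inv_pow_eq (by norm_num : 3 ≤ 6) z
  have : g3 z = 140 * ∑' p : ℤ × ℤ, (((p.1 : ℂ) + (p.2 : ℂ) * z) ^ 6)⁻¹ := by
    unfold g3
    congr 1
    refine tsum_congr fun p => ?_
    split_ifs with hp
    · simp [hp]
    · rfl
  rw [this, h]
  push_cast
  rw [riemannZeta_six]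
  ring

lemma klein_coe (z : ℍ) : klein z = E₄ z ^ 3 / discriminant z := by
  have hd := discriminant_ne_zero z
  rw [discriminant_eq_E₄_cube_sub_E₆_sq] at *
  have h2 : E₄ z ^ 3 - E₆ z ^ 2 ≠ 0 := fun h => hd (by rw [h]; simp)
  have hpi : (Real.pi : ℂ) ≠ 0 := by exact_mod_cast Real.pi_ne_zero
  unfold klein
  rw [g2_coe, g3_coe]
  have h3 : (4 / 3 * (Real.pi : ℂ) ^ 4 * E₄ z) ^ 3 - 27 * (8 / 27 * Real.pi ^ 6 * E₆ z) ^ 2 =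
    64 / 27 * Real.pi ^ 12 * (E₄ z ^ 3 - E₆ z ^ 2) := by ring
  rw [h3]
  field_simp
  ring

lemma mdifferentiable_klein : MDifferentiable 𝓘(ℂ) 𝓘(ℂ) (fun z : ℍ => klein z) := by
  have h1 : MDifferentiable 𝓘(ℂ) 𝓘(ℂ) E₄ := ModularFormClass.holo E₄
  have h2 : MDifferentiable 𝓘(ℂ) 𝓘(ℂ) CuspForm.discriminant := CuspFormClass.holo _
  rw [mdifferentiable_iff] at *
  have : DifferentiableOn ℂ (fun z => (E₄ ∘ ofComplex) z ^ 3 / (CuspForm.discriminant ∘ ofComplex) z)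
      {z : ℂ | 0 < z.im} := (h1.pow 3).div h2 (fun z hz => discriminant_ne_zero _)
  refine this.congr fun z hz => ?_
  simp [klein_coe]

lemma levelOne_smul {F : Type*} [FunLike F ℍ ℂ] {k : ℤ} [SlashInvariantFormClass F 𝒮ℒ k] (f : F)
    (γ : SL(2, ℤ)) (z : ℍ) : f (γ • z) = denom γ z ^ k * f z :=
  SlashInvariantForm.slash_action_eqn'' (Γ := 𝒮ℒ) f (γ := Matrix.SpecialLinearGroup.mapGL ℝ γ) ⟨γ, rfl⟩ z

lemma klein_smul (γ : SL(2, ℤ)) (z : ℍ) : klein ↑(γ • z) = klein z := by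
  have h1 := levelOne_smul E₄ γ z
  have h2 := levelOne_smul CuspForm.discriminant γ z
  rw [CuspForm.coe_discriminant] at h2
  rw [klein_coe, klein_coe, h1, h2]
  have := denom_ne_zero γ z
  have := discriminant_ne_zero z
  field_simp

end JFunction
section QExpansions

open UpperHalfPlane PowerSeries
open scoped Manifold

/-- `A` is the Laurent expansion of `f` in the parameter `t = exp (2πiτ/h)`, multiplied by `t ^ N`. -/
def HasExp (h : ℕ) (f : ℍ → ℂ) (N : ℕ) (A : PowerSeries ℂ) : Prop :=
  ∀ τ : ℍ, HasSum (fun n => coeff n A * Function.Periodic.qParam h τ ^ n)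
    (Function.Periodic.qParam h τ ^ N * f τ)

namespace HasExp

variable {h : ℕ} {f g : ℍ → ℂ} {N M : ℕ} {A B : PowerSeries ℂ}

lemma unique (hh : 0 < h) (hA : HasExp h f N A) (hB : HasExp h f N B) : A = B := by
  have hh' : (0 : ℝ) < h := by exact_mod_cast hh
  ext n
  have h0 : cuspFunction (h : ℝ) (0 : ℍ → ℂ) = 0 := by
    have h0 : AnalyticAt ℂ (cuspFunction (h : ℝ) (0 : ℍ → ℂ)) 0 :=
      analyticAt_cuspFunction_zero hh' (fun x => by simp) mdifferentiable_const
        (Filter.const_boundedAtFilter _ 0)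
    simpa using! cuspFunction_smul (f := 0) h0.continuousAt 0
  have key := (hasFPowerSeriesOnBall_cuspFunction (f := (0 : ℍ → ℂ)) (h := h)
    (c := fun n => coeff n A - coeff n B) hh' (by rw [h0]; exact analyticAt_const)
    (fun τ => by simpa [sub_mul] using! (hA τ).sub (hB τ))).hasFPowerSeriesAt
  rw [h0] at key
  have := key.eq_zero
  have h2 := congrFun this n
  rw [FormalMultilinearSeries.ofScalars] at h2
  have h3 := congrArg (fun p => p (fun _ => 1)) h2
  simpa [sub_eq_zero] using h3

lemma shift (k : ℕ) (hA : HasExp h f N A) : HasExp h f (N + k) (X ^ k * A) := by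
  intro τ
  have := (hA τ).mul_left (Function.Periodic.qParam h τ ^ k)
  rw [← hasSum_nat_add_iff' k]
  rw [Finset.sum_eq_zero (fun i hi => by
    rw [coeff_X_pow_mul', if_neg (by simpa using hi), zero_mul])]
  simp only [coeff_X_pow_mul', if_pos (Nat.le_add_left _ _), Nat.add_sub_cancel, sub_zero]
  convert! this using 1
  · ext n; ring
  · ring

lemma unshift (k : ℕ) (hA : HasExp h f (N + k) (X ^ k * A)) : HasExp h f N A := by
  intro τ
  have h0 : Function.Periodic.qParam (h : ℝ) (τ : ℂ) ≠ 0 := Complex.exp_ne_zero _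
  have := (hA τ).mul_left (Function.Periodic.qParam h τ ^ k)⁻¹
  rw [← hasSum_nat_add_iff' k] at this
  rw [Finset.sum_eq_zero (fun i hi => by
    rw [coeff_X_pow_mul', if_neg (by simpa using hi), zero_mul, mul_zero])] at this
  simp only [coeff_X_pow_mul', if_pos (Nat.le_add_left _ _), Nat.add_sub_cancel, sub_zero] at this
  convert! this using 1
  · ext n; field_simp; ring
  · field_simp; ring

lemma add (hA : HasExp h f N A) (hB : HasExp h g N B) : HasExp h (f + g) N (A + B) := fun τ => by
  simpa [add_mul, mul_add] using (hA τ).add (hB τ)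

lemma neg (hA : HasExp h f N A) : HasExp h (-f) N (-A) := fun τ => by
  simpa using (hA τ).neg

lemma const_mul (c : ℂ) (hA : HasExp h f N A) : HasExp h (fun τ => c * f τ) N (C c * A) :=
  fun τ => by
    convert! (hA τ).mul_left c using 1
    · ext n; simp [mul_assoc]
    · ring

lemma const (h : ℕ) (c : ℂ) : HasExp h (fun _ => c) 0 (C c) := fun τ => by
  convert! hasSum_ite_eq 0 c using 1
  · ext n; rcases eq_or_ne n 0 with rfl | hn <;> simp [coeff_C, *]
  · simp

lemma mul (hA : HasExp h f N A) (hB : HasExp h g M B) : HasExp h (f * g) (N + M) (A * B) := by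
  intro τ
  have h1 := (hA τ).summable.norm
  have h2 := (hB τ).summable.norm
  have h3 := tsum_mul_tsum_eq_tsum_sum_antidiagonal_of_summable_norm h1 h2
  have h4 := summable_norm_sum_mul_antidiagonal_of_summable_norm h1 h2
  rw [(hA τ).tsum_eq, (hB τ).tsum_eq] at h3
  have h5 := h4.of_norm.hasSum
  rw [← h3] at h5
  convert! h5 using 1
  · ext n
    rw [coeff_mul, Finset.sum_mul]
    refine Finset.sum_congr rfl fun p hp => ?_
    rw [← Finset.HasAntidiagonal.mem_antidiagonal.mp hp, pow_add]
    ring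
  · simp only [Pi.mul_apply]; ring

lemma qParam_mul (h k : ℕ) (hk : 0 < k) (τ : ℂ) :
    Function.Periodic.qParam (h * k : ℕ) τ ^ k = Function.Periodic.qParam h τ := by
  have : (k : ℂ) ≠ 0 := by exact_mod_cast hk.ne'
  rw [Function.Periodic.qParam, Function.Periodic.qParam, ← Complex.exp_nat_mul]
  congr 1
  rcases eq_or_ne (h : ℂ) 0 with h0 | h0
  · simp [h0]
  · push_cast; field_simp

/-- Substituting a point `z` whose parameter is `ζ * t ^ k`. -/
lemma comp {z : ℍ → ℍ} {h' k : ℕ} (hk : k ≠ 0) {ζ : ℂ} (hζ : ζ ≠ 0)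
    (hz : ∀ τ : ℍ, Function.Periodic.qParam h (z τ) = ζ * Function.Periodic.qParam h' τ ^ k)
    (hA : HasExp h f N A) :
    HasExp h' (fun τ => f (z τ)) (N * k)
      (C (ζ⁻¹ ^ N) * expand k hk (PowerSeries.mk fun n => ζ ^ n * coeff n A)) := by
  intro τ
  have h1 := (hA (z τ)).mul_left (ζ⁻¹ ^ N)
  rw [hz] at h1
  have hinj : Function.Injective (fun n : ℕ => k * n) :=
    mul_right_injective₀ hk
  rw [← hinj.hasSum_iff]
  · convert! h1 using 1
    · ext n
      simp only [Function.comp, coeff_C_mul, coeff_expand_mul, coeff_mk]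
      ring
    · rw [mul_pow, inv_pow, ← pow_mul, mul_comm N k]
      field_simp
  · intro n hn
    rw [coeff_C_mul, coeff_expand_of_not_dvd, mul_zero, zero_mul]
    rintro ⟨m, rfl⟩
    exact hn ⟨m, rfl⟩

lemma isBoundedAtImInfty (hh : 0 < h) (hA : HasExp h f 0 A) : IsBoundedAtImInfty f := by
  refine isBoundedAtImInfty_of_hasSum_qExpansion (h := h) (c := fun n => coeff n A)
    (by exact_mod_cast hh) fun τ => ?_
  simpa using hA τ

end HasExp

end QExpansions
section KleinExpansion

open UpperHalfPlane PowerSeries ModularForm EisensteinSeries MatrixGroups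
open scoped Manifold ArithmeticFunction.sigma

lemma hasExp_levelOne {F : Type*} [FunLike F ℍ ℂ] {k : ℤ} [ModularFormClass F 𝒮ℒ k] (f : F) :
    HasExp 1 f 0 (qExpansion 1 f) := fun τ => by
  simpa using ModularForm.hasSum_qExpansion f one_pos one_mem_strictPeriods_SL τ

/-- The power series `∑ σ_k(n) X^n`. -/
noncomputable def sigmaSeries (k : ℕ) : PowerSeries ℤ := .mk fun n => (σ k n : ℤ)

lemma hasExp_E₄ : HasExp 1 E₄ 0 ((1 + 240 * sigmaSeries 3).map (Int.castRingHom ℂ)) := by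
  convert hasExp_levelOne E₄ using 1
  ext n
  rw [E_qExpansion_coeff _ ⟨2, rfl⟩]
  have hb : bernoulli 4 = -1 / 30 := by
    rw [bernoulli_eq_bernoulli'_of_ne_one (by norm_num), bernoulli'_four]
  have h240 : (240 : PowerSeries ℤ) = C 240 := (map_ofNat C 240).symm
  rw [coeff_map, map_add, h240, coeff_C_mul, coeff_one, sigmaSeries, coeff_mk, hb]
  split_ifs with h
  · simp [h]
  · push_cast; simp; norm_num

lemma hasExp_E₆ : HasExp 1 E₆ 0 ((1 - 504 * sigmaSeries 5).map (Int.castRingHom ℂ)) := by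
  convert hasExp_levelOne E₆ using 1
  ext n
  rw [E_qExpansion_coeff _ ⟨3, rfl⟩]
  have hb : bernoulli 6 = 1 / 42 := by
    rw [bernoulli_eq_bernoulli'_of_ne_one (by norm_num)]
    rw [bernoulli'_def]
    have e5 : bernoulli' 5 = 0 := bernoulli'_eq_zero_of_odd (by decide) (by norm_num)
    simp [Finset.sum_range_succ, bernoulli'_zero, bernoulli'_one, bernoulli'_two, bernoulli'_three,
      bernoulli'_four, e5]
    norm_num [Nat.choose]
  have h504 : (504 : PowerSeries ℤ) = C 504 := (map_ofNat C 504).symm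
  rw [coeff_map, map_sub, h504, coeff_C_mul, coeff_one, sigmaSeries, coeff_mk, hb]
  split_ifs with h
  · simp [h]
  · push_cast; simp; norm_num

lemma twelve_dvd_sigma (n : ℕ) : (12 : ℤ) ∣ 5 * (σ 3 n : ℤ) + 7 * (σ 5 n : ℤ) := by
  rw [ArithmeticFunction.sigma_apply, ArithmeticFunction.sigma_apply]
  push_cast
  rw [Finset.mul_sum, Finset.mul_sum, ← Finset.sum_add_distrib]
  refine Finset.dvd_sum fun d _ => ?_
  refine (ZMod.intCast_zmod_eq_zero_iff_dvd _ 12).mp ?_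
  push_cast
  generalize (d : ZMod 12) = x
  revert x
  decide

lemma exists_hasExp_discriminant : ∃ D : PowerSeries ℤ, constantCoeff D = 1 ∧
    HasExp 1 discriminant 0 ((X * D).map (Int.castRingHom ℂ)) := by
  choose w hw using twelve_dvd_sigma
  set S3 := sigmaSeries 3
  set S5 := sigmaSeries 5
  have hW : 5 * S3 + 7 * S5 = 12 * PowerSeries.mk w := by
    have h5 : (5 : PowerSeries ℤ) = C 5 := (map_ofNat C 5).symm
    have h7 : (7 : PowerSeries ℤ) = C 7 := (map_ofNat C 7).symm
    have h12 : (12 : PowerSeries ℤ) = C 12 := (map_ofNat C 12).symm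
    ext n
    rw [h5, h7, h12, map_add, coeff_C_mul, coeff_C_mul, coeff_C_mul, coeff_mk, ← hw]
    simp only [S3, S5, sigmaSeries, coeff_mk]
  set E := PowerSeries.mk w + 100 * S3 ^ 2 + 8000 * S3 ^ 3 - 147 * S5 ^ 2 with hE
  have hE' : (1 + 240 * S3) ^ 3 - (1 - 504 * S5) ^ 2 = 1728 * E := by
    rw [hE]
    linear_combination 144 * hW
  have hexp : HasExp 1 discriminant 0 (E.map (Int.castRingHom ℂ)) := by
    have h1 := ((hasExp_E₄.mul (hasExp_E₄.mul hasExp_E₄)).add (hasExp_E₆.mul hasExp_E₆).neg).const_mul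
      (1 / 1728)
    convert! h1 using 1
    · ext z
      rw [discriminant_eq_E₄_cube_sub_E₆_sq]
      simp only [Pi.add_apply, Pi.mul_apply, Pi.neg_apply]
      ring
    · rw [← map_mul, ← map_mul, ← map_mul, ← map_neg, ← map_add]
      have : (1 + 240 * S3) * ((1 + 240 * S3) * (1 + 240 * S3)) + -((1 - 504 * S5) * (1 - 504 * S5)) =
        1728 * E := by rw [← hE']; ring
      rw [this, map_mul, map_ofNat, ← mul_assoc]
      have h1728 : (1728 : PowerSeries ℂ) = C 1728 := (map_ofNat C 1728).symm
      rw [h1728, ← map_mul]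
      norm_num
  have hun := hexp.unique one_pos (hasExp_levelOne CuspForm.discriminant)
  have hcoe (n : ℕ) : ((coeff n E : ℤ) : ℂ) = coeff n (qExpansion 1 discriminant) := by
    have := congrArg (coeff n) hun
    rw [coeff_map] at this
    simpa using this
  have h0 : constantCoeff E = 0 := by
    have := hcoe 0
    have h2 := CuspFormClass.qExpansion_coeff_zero CuspForm.discriminant one_pos one_mem_strictPeriods_SL
    rw [CuspForm.coe_discriminant] at h2
    rw [h2] at this
    simpa using this
  obtain ⟨D, hD⟩ := X_dvd_iff.mpr h0
  refine ⟨D, ?_, hD ▸ hexp⟩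
  have := hcoe 1
  rw [discriminant_qExpansion_coeff_one, hD] at this
  have h3 : coeff 1 (X * D) = coeff 0 D := coeff_succ_X_mul 0 D
  rw [h3] at this
  simpa using this

lemma exists_hasExp_klein : ∃ A : PowerSeries ℤ, constantCoeff A = 1 ∧
    HasExp 1 (fun τ : ℍ => klein τ) 1 (A.map (Int.castRingHom ℂ)) := by
  obtain ⟨D, hD1, hD⟩ := exists_hasExp_discriminant
  have hDmd : MDifferentiable 𝓘(ℂ) 𝓘(ℂ) discriminant := CuspForm.discriminant.holo'
  set q : ℍ → ℂ := fun τ => Function.Periodic.qParam 1 τ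
  set f : ℍ → ℂ := fun τ => q τ * klein τ with hf
  have hper : Function.Periodic (f ∘ ofComplex) (1 : ℝ) := by
    intro w
    by_cases hw : 0 < w.im
    · have hw' : 0 < (w + (1 : ℝ)).im := by simpa using hw
      simp only [Function.comp, hf, q]
      rw [ofComplex_apply_of_im_pos hw, ofComplex_apply_of_im_pos hw']
      have h1 := klein_smul ModularGroup.T ⟨w, hw⟩
      have h2 : ((ModularGroup.T • (⟨w, hw⟩ : ℍ) : ℍ) : ℂ) = w + (1 : ℝ) := by
        rw [UpperHalfPlane.modular_T_smul]
        simp [add_comm]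
      rw [h2] at h1
      have h3 : Function.Periodic.qParam 1 (w + (1 : ℝ)) = Function.Periodic.qParam 1 w := by
        simp only [Function.Periodic.qParam, Complex.ofReal_one, div_one]
        rw [mul_add, Complex.exp_add, mul_one, Complex.exp_two_pi_mul_I, mul_one]
      change Function.Periodic.qParam 1 (w + (1 : ℝ)) * klein (w + (1 : ℝ)) = Function.Periodic.qParam 1 w * klein w
      rw [h1, h3]
    · have hw' : ¬ 0 < (w + (1 : ℝ)).im := by simpa using hw
      simp only [Function.comp]
      rw [ofComplex_apply_of_im_nonpos (not_lt.mp hw), ofComplex_apply_of_im_nonpos (not_lt.mp hw')]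
  have hqd : MDifferentiable 𝓘(ℂ) 𝓘(ℂ) q := by
    rw [UpperHalfPlane.mdifferentiable_iff]
    have : DifferentiableOn ℂ (fun z => Function.Periodic.qParam 1 z) {z : ℂ | 0 < z.im} :=
      (Function.Periodic.differentiable_qParam).differentiableOn
    refine this.congr fun z hz => ?_
    simp [q, ofComplex_apply_of_im_pos hz]
  have hhol : MDifferentiable 𝓘(ℂ) 𝓘(ℂ) f := hqd.mul mdifferentiable_klein
  have hbdd : IsBoundedAtImInfty f := by
    have h1 : (fun τ : ℍ => q τ / discriminant τ) =O[atImInfty] (fun _ => (1 : ℝ)) := by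
      refine (Asymptotics.div_isBoundedUnder_of_isBigO ?_).isBigO_one ℝ
      refine Asymptotics.IsBigO.trans ?_ exp_isBigO_discriminant
      refine Asymptotics.IsBigO.of_bound 1 (Filter.Eventually.of_forall fun τ => ?_)
      simp only [q, Function.Periodic.norm_qParam, Real.norm_eq_abs, Real.abs_exp, one_mul, div_one, coe_im, le_refl]
    have h2 : IsBoundedAtImInfty E₄ := hasExp_E₄.isBoundedAtImInfty one_pos
    have h3 : IsBoundedAtImInfty ((fun τ : ℍ => q τ / discriminant τ) * (⇑E₄ * ⇑E₄ * ⇑E₄)) :=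
      Filter.BoundedAtFilter.mul h1 ((h2.mul h2).mul h2)
    convert! h3 using 1
    ext τ
    simp only [hf, klein_coe, Pi.mul_apply]
    ring
  have hsum : HasExp 1 f 0 (qExpansion 1 f) := fun τ => by
    simpa using hasSum_qExpansion one_pos hper hhol hbdd τ
  have hq : HasExp 1 q 0 X := fun τ => by
    have := hasSum_ite_eq (1 : ℕ) (q τ)
    convert! this using 1
    · ext n
      rw [coeff_X]
      split_ifs with hn
      · simp [hn, q]
      · simp
    · simp
  have e1 := hD.mul hsum
  have e2 := hq.mul (hasExp_E₄.mul (hasExp_E₄.mul hasExp_E₄))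
  have e3 : discriminant * f = q * (⇑E₄ * (⇑E₄ * ⇑E₄)) := by
    ext τ
    have := discriminant_ne_zero τ
    simp only [hf, klein_coe, Pi.mul_apply]
    field_simp
  rw [e3] at e1
  have e4 := e1.unique one_pos e2
  rw [map_mul, map_X, mul_assoc] at e4
  have e5 := mul_left_cancel₀ X_ne_zero e4
  set B := (1 + 240 * sigmaSeries 3) * ((1 + 240 * sigmaSeries 3) * (1 + 240 * sigmaSeries 3)) with hB
  obtain ⟨u, hu⟩ : IsUnit D := isUnit_iff_constantCoeff.mpr (by rw [hD1]; exact isUnit_one)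
  have hA : qExpansion 1 f = ((↑u⁻¹ * B : PowerSeries ℤ)).map (Int.castRingHom ℂ) := by
    have h2 : (D.map (Int.castRingHom ℂ)) * ((↑u⁻¹ : PowerSeries ℤ)).map (Int.castRingHom ℂ) = 1 := by
      rw [← map_mul, ← hu, Units.mul_inv, map_one]
    rw [map_mul, hB, map_mul, map_mul, ← e5, ← mul_assoc, mul_comm (PowerSeries.map _ _), h2, one_mul]
  refine ⟨↑u⁻¹ * B, ?_, ?_⟩
  · have h1 : constantCoeff (D * ((↑u⁻¹ : PowerSeries ℤ) * B)) = constantCoeff B := by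
      rw [← mul_assoc, ← hu, Units.mul_inv, one_mul]
    rw [map_mul, hD1, one_mul] at h1
    rw [h1, hB]
    simp [sigmaSeries, map_ofNat]
  · rw [← hA]
    intro τ
    have := hsum τ
    simpa [hf, q] using this

end KleinExpansion
section Hauptmodul

open UpperHalfPlane PowerSeries ModularForm MatrixGroups
open scoped Manifold

lemma hasExp_sub_const {h : ℕ} {f : ℍ → ℂ} {A : PowerSeries ℂ} (hA : HasExp h f 0 A) :
    ∃ g : ℍ → ℂ, (∀ τ : ℍ, f τ = constantCoeff A + Function.Periodic.qParam h τ * g τ) ∧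
      HasExp h g 0 (.mk fun n => coeff (n + 1) A) := by
  have hne : ∀ τ : ℍ, Function.Periodic.qParam (h : ℝ) (τ : ℂ) ≠ 0 := fun τ => Complex.exp_ne_zero _
  refine ⟨fun τ => (Function.Periodic.qParam h τ)⁻¹ * (f τ - constantCoeff A), fun τ => ?_, ?_⟩
  · field_simp [hne τ]; ring
  · refine HasExp.unshift 1 fun τ => ?_
    have h1 := (hA.add (HasExp.const h (constantCoeff A)).neg) τ
    have h2 : X ^ 1 * (PowerSeries.mk fun n => coeff (n + 1) A) = A + -C (constantCoeff A) := by
      ext n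
      rcases n with _ | n
      · simp
      · simp
    rw [h2]
    convert! h1 using 1
    have := hne τ
    simp only [Pi.add_apply, Pi.neg_apply]
    field_simp
    ring

lemma HasExp.tendsto {h : ℕ} (hh : 0 < h) {f : ℍ → ℂ} {N : ℕ} {A : PowerSeries ℂ}
    (hA : HasExp h f N A) :
    Filter.Tendsto (fun τ : ℍ => Function.Periodic.qParam h τ ^ N * f τ) atImInfty
      (nhds (constantCoeff A)) := by
  have h0 : HasExp h (fun τ : ℍ => Function.Periodic.qParam h τ ^ N * f τ) 0 A := fun τ => by
    simpa using hA τ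
  obtain ⟨g, hg, hgA⟩ := hasExp_sub_const h0
  have hq : Filter.ZeroAtFilter atImInfty (fun τ : ℍ => Function.Periodic.qParam (h : ℝ) τ) :=
    qParam_tendsto_atImInfty (by exact_mod_cast hh)
  have h1 : Filter.ZeroAtFilter atImInfty (g * (fun τ : ℍ => Function.Periodic.qParam (h : ℝ) τ)) :=
    Filter.BoundedAtFilter.mul_zeroAtFilter (hgA.isBoundedAtImInfty hh) hq
  have h2 := Filter.Tendsto.const_add (constantCoeff A) h1
  simp only [add_zero] at h2
  refine h2.congr fun τ => ?_
  rw [hg τ, Pi.mul_apply, mul_comm (g τ)]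

lemma exists_eq_const_of_invariant {f : ℍ → ℂ} (hinv : ∀ (γ : SL(2, ℤ)) z, f (γ • z) = f z)
    (hhol : MDifferentiable 𝓘(ℂ) 𝓘(ℂ) f) (hbdd : IsBoundedAtImInfty f) : ∃ c, ∀ z, f z = c := by
  have hslash : ∀ γ : SL(2, ℤ), f ∣[(0 : ℤ)] γ = f := fun γ => by
    ext z
    rw [SL_slash_apply, hinv]
    simp
  let F : ModularForm 𝒮ℒ 0 :=
    { toFun := f
      slash_action_eq' := fun _ ⟨γ, hγ⟩ => hγ ▸ hslash γ
      holo' := hhol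
      bdd_at_cusps' {c} hc := by
        rw [Subgroup.IsArithmetic.isCusp_iff_isCusp_SL2Z] at hc
        rw [OnePoint.isBoundedAt_iff_forall_SL2Z hc]
        intro γ _
        rw [hslash γ]
        exact hbdd }
  obtain ⟨c, hc⟩ := ModularFormClass.levelOne_weight_zero_const F
  exact ⟨c, fun z => congrFun hc z⟩

theorem klein_surjective (c : ℂ) : ∃ τ : ℍ, klein τ = c := by
  by_contra! hne
  obtain ⟨A, hA1, hA⟩ := exists_hasExp_klein
  have hq : Filter.Tendsto (fun τ : ℍ => Function.Periodic.qParam 1 τ) atImInfty (nhds 0) :=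
    qParam_tendsto_atImInfty one_pos
  have h1 := hA.tendsto one_pos
  simp only [Nat.cast_one, pow_one] at h1
  have hA1' : constantCoeff (A.map (Int.castRingHom ℂ)) = 1 := by
    rw [← coeff_zero_eq_constantCoeff_apply, coeff_map, coeff_zero_eq_constantCoeff_apply, hA1]
    simp
  rw [hA1'] at h1
  have h2 := h1.sub (hq.mul_const c)
  have h3 := hq.div h2 (by simp)
  simp only [zero_mul, sub_zero, zero_div] at h3
  have hlim : IsZeroAtImInfty (fun τ : ℍ => (klein τ - c)⁻¹) := by
    refine h3.congr fun τ => ?_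
    have := hne τ
    have h4 : Function.Periodic.qParam 1 (τ : ℂ) ≠ 0 := Complex.exp_ne_zero _
    have h5 : klein τ - c ≠ 0 := sub_ne_zero.mpr this
    simp only [Pi.div_apply]
    rw [← mul_sub]
    field_simp
  obtain ⟨d, hd⟩ := exists_eq_const_of_invariant (f := fun τ : ℍ => (klein τ - c)⁻¹)
    (fun γ z => by simp only [klein_smul]) (by
      have := mdifferentiable_klein
      rw [UpperHalfPlane.mdifferentiable_iff] at *
      exact (this.sub_const c).inv fun z hz => sub_ne_zero.mpr (hne _))
    (hlim.boundedAtFilter)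
  have hd0 : d = 0 := by
    refine tendsto_nhds_unique (f := fun _ : ℍ => d) (l := atImInfty) tendsto_const_nhds ?_
    exact hlim.congr hd
  have := hd I
  rw [hd0, _root_.inv_eq_zero, sub_eq_zero] at this
  exact hne _ this

lemma HasExp.pow {h : ℕ} {f : ℍ → ℂ} {N : ℕ} {A : PowerSeries ℂ} (hA : HasExp h f N A) (k : ℕ) :
    HasExp h (fun τ => f τ ^ k) (k * N) (A ^ k) := by
  induction k with
  | zero => simpa using HasExp.const h 1
  | succ k ih =>
    rw [Nat.succ_mul, pow_succ]
    exact ih.mul hA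

lemma qParam_one_eq_pow {h : ℕ} (hh : 0 < h) (τ : ℂ) :
    Function.Periodic.qParam (1 : ℕ) τ = 1 * Function.Periodic.qParam h τ ^ h := by
  rw [one_mul, ← HasExp.qParam_mul 1 h hh, one_mul]

lemma exists_hasExp_klein_level {h : ℕ} (hh : 0 < h) : ∃ A : PowerSeries ℤ, constantCoeff A = 1 ∧
    HasExp h (fun τ : ℍ => klein τ) h (A.map (Int.castRingHom ℂ)) := by
  obtain ⟨A, hA1, hA⟩ := exists_hasExp_klein
  refine ⟨expand h hh.ne' A, ?_, ?_⟩
  · rw [constantCoeff_expand, hA1]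
  · have := hA.comp (z := id) hh.ne' one_ne_zero (fun τ => qParam_one_eq_pow hh τ)
    convert! this using 1
    · rw [one_mul]
    · ext n
      by_cases hn : h ∣ n <;> simp [coeff_expand, hn]

lemma HasExp.dvd_of_invariant {h : ℕ} (hh : 0 < h) {f : ℍ → ℂ} {N : ℕ} {A : PowerSeries ℂ}
    (hinv : ∀ (γ : SL(2, ℤ)) z, f (γ • z) = f z) (hA : HasExp h f N A) (hA0 : coeff 0 A ≠ 0) :
    h ∣ N := by
  set ζ : ℂ := Complex.exp (2 * Real.pi * Complex.I / h) with hζ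
  have hprim : IsPrimitiveRoot ζ h := Complex.isPrimitiveRoot_exp h hh.ne'
  have hζ0 : ζ ≠ 0 := Complex.exp_ne_zero _
  have e1 := hA.comp (z := fun τ => ModularGroup.T • τ) one_ne_zero hζ0 (h' := h) (fun τ => by
    rw [UpperHalfPlane.modular_T_smul, hζ, Function.Periodic.qParam, Function.Periodic.qParam,
      pow_one, ← Complex.exp_add]
    congr 1
    simp
    ring)
  simp only [hinv, mul_one] at e1
  have e2 := congrArg (coeff 0) (e1.unique hh hA)
  rw [coeff_C_mul, coeff_expand, if_pos (dvd_zero _), coeff_mk] at e2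
  simp only [pow_zero, one_mul, Nat.zero_div] at e2
  have e3 : ζ⁻¹ ^ N = 1 := mul_right_cancel₀ hA0 (by rw [e2, one_mul])
  rw [inv_pow, inv_eq_one] at e3
  exact hprim.dvd_of_pow_eq_one _ e3

/-- An invariant function with a Laurent expansion having coefficients in `I` is a polynomial in
`klein` with coefficients in `I`. -/
theorem exists_polynomial_klein (I : AddSubgroup ℂ) {h : ℕ} (hh : 0 < h) (N : ℕ) :
    ∀ (f : ℍ → ℂ) (A : PowerSeries ℂ), (∀ (γ : SL(2, ℤ)) z, f (γ • z) = f z) →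
      MDifferentiable 𝓘(ℂ) 𝓘(ℂ) f → HasExp h f N A → (∀ n, coeff n A ∈ I) →
      ∃ P : Polynomial ℂ, (∀ n, P.coeff n ∈ I) ∧ (∀ z : ℍ, f z = P.eval (klein z)) ∧
        h * P.natDegree ≤ N ∧ ∀ M, N = h * M → P.coeff M = coeff 0 A := by
  induction N with
  | zero =>
    intro f A hinv hhol hA hAI
    obtain ⟨c, hc⟩ := exists_eq_const_of_invariant hinv hhol (hA.isBoundedAtImInfty hh)
    have hAc : A = C c := hA.unique hh (by
      rw [show f = fun _ => c from funext hc]; exact HasExp.const h c)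
    refine ⟨Polynomial.C c, fun n => ?_, fun z => by simp [hc], by simp, fun M hM => ?_⟩
    · rw [Polynomial.coeff_C]
      split_ifs with hn
      · simpa [hAc] using hAI 0
      · exact zero_mem I
    · have : M = 0 := by simpa [hh.ne'] using hM.symm
      simp [this, hAc]
  | succ N ih =>
    intro f A hinv hhol hA hAI
    have low : ∀ (f : ℍ → ℂ) (A : PowerSeries ℂ), (∀ (γ : SL(2, ℤ)) z, f (γ • z) = f z) →
        MDifferentiable 𝓘(ℂ) 𝓘(ℂ) f → HasExp h f (N + 1) A → (∀ n, coeff n A ∈ I) →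
        coeff 0 A = 0 → ∃ P : Polynomial ℂ, (∀ n, P.coeff n ∈ I) ∧
          (∀ z : ℍ, f z = P.eval (klein z)) ∧ h * P.natDegree ≤ N := by
      intro f A hinv hhol hA hAI hA0
      obtain ⟨B, rfl⟩ := X_dvd_iff.mpr (by simpa using hA0)
      have hB : HasExp h f N B := HasExp.unshift 1 (by simpa using hA)
      obtain ⟨P, h1, h2, h3, -⟩ := ih f B hinv hhol hB
        (fun n => by simpa [coeff_succ_X_mul] using hAI (n + 1))
      exact ⟨P, h1, h2, h3⟩
    by_cases hA0 : coeff 0 A = 0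
    · obtain ⟨P, h1, h2, h3⟩ := low f A hinv hhol hA hAI hA0
      refine ⟨P, h1, h2, by omega, fun M hM => ?_⟩
      rw [hA0]
      refine Polynomial.coeff_eq_zero_of_natDegree_lt ?_
      by_contra! hlt
      have := Nat.mul_le_mul_left h hlt
      omega
    · obtain ⟨M, hM⟩ : h ∣ N + 1 := hA.dvd_of_invariant hh hinv hA0
      obtain ⟨J, hJ1, hJ⟩ := exists_hasExp_klein_level hh
      have hJM := (hJ.pow M).const_mul (coeff 0 A)
      rw [mul_comm M h, ← hM] at hJM
      have hJ1' : coeff 0 ((J.map (Int.castRingHom ℂ)) ^ M) = 1 := by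
        rw [← map_pow, coeff_map, coeff_zero_eq_constantCoeff_apply, map_pow, hJ1]; simp
      obtain ⟨P, h1, h2, h3⟩ := low (f + -(fun τ : ℍ => coeff 0 A * klein τ ^ M)) _
        (fun γ z => by simp only [Pi.add_apply, Pi.neg_apply, hinv, klein_smul])
        (by
          have := mdifferentiable_klein
          rw [UpperHalfPlane.mdifferentiable_iff] at *
          exact hhol.add (((this.pow M).const_mul _).neg))
        (hA.add hJM.neg)
        (fun n => by
          rw [map_add, map_neg, coeff_C_mul, ← map_pow, coeff_map]
          refine add_mem (hAI n) (neg_mem ?_)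
          rw [mul_comm, eq_intCast, ← zsmul_eq_mul]
          exact zsmul_mem (hAI 0) _)
        (by rw [map_add, map_neg, coeff_C_mul, hJ1']; simp)
      have hMpos : h * P.natDegree < h * M := by omega
      have hdeg : P.natDegree < M := lt_of_mul_lt_mul_left hMpos (Nat.zero_le _)
      refine ⟨P + Polynomial.C (coeff 0 A) * Polynomial.X ^ M, fun n => ?_, fun z => ?_, ?_, ?_⟩
      · rw [Polynomial.coeff_add, Polynomial.coeff_C_mul_X_pow]
        split_ifs
        · exact add_mem (h1 n) (hAI 0)
        · exact add_mem (h1 n) (zero_mem I)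
      · have := h2 z
        simp only [Pi.add_apply, Pi.neg_apply] at this
        simp only [Polynomial.eval_add, Polynomial.eval_mul, Polynomial.eval_C, Polynomial.eval_pow,
          Polynomial.eval_X]
        rw [← this]; ring
      · rw [hM]
        refine Nat.mul_le_mul_left h ?_
        refine (Polynomial.natDegree_add_le _ _).trans (max_le hdeg.le ?_)
        exact Polynomial.natDegree_C_mul_X_pow_le _ _
      · intro M' hM'
        have : M' = M := Nat.eq_of_mul_eq_mul_left hh (by omega)
        rw [this, Polynomial.coeff_add, Polynomial.coeff_eq_zero_of_natDegree_lt hdeg]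
        simp

end Hauptmodul

section

open UpperHalfPlane Filter Topology PeriodPair

lemma eventually_weierstrassP_eq_of_invariants (L M : PeriodPair) (h2 : L.g₂ = M.g₂) (h3 : L.g₃ = M.g₃) :
    L.weierstrassP =ᶠ[𝓝[≠] 0] M.weierstrassP := by
  have hP1 := L.analyticAt_weierstrassPExcept 0
  have hP2 := M.analyticAt_weierstrassPExcept 0
  have hQ1 := L.analyticAt_derivWeierstrassPExcept 0
  have hQ2 := M.analyticAt_derivWeierstrassPExcept 0
  have hmem (K : PeriodPair) : ∀ᶠ z in 𝓝[≠] (0 : ℂ), z ≠ 0 ∧ z ∉ K.lattice := by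
    filter_upwards [self_mem_nhdsWithin, mem_nhdsWithin_of_mem_nhds
      (K.compl_lattice_sdiff_singleton_mem_nhds _)] with w hw hw'
    exact ⟨hw, by simp_all⟩
  have hP (K : PeriodPair) (z : ℂ) :
      K.weierstrassP z = K.weierstrassPExcept 0 z + (z ^ 2)⁻¹ := by
    simpa using (K.weierstrassPExcept_add 0 z).symm
  have hQ (K : PeriodPair) (z : ℂ) :
      K.derivWeierstrassP z = K.derivWeierstrassPExcept 0 z - 2 / z ^ 3 := by
    have := K.derivWeierstrassPExcept_sub 0 z
    simpa using this.symm
  set h : ℂ → ℂ := fun z => L.weierstrassPExcept 0 z - M.weierstrassPExcept 0 z with hh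
  have hha : AnalyticAt ℂ h 0 := hP1.sub hP2
  by_cases hz : ∀ᶠ z in 𝓝 0, h z = 0
  · filter_upwards [mem_nhdsWithin_of_mem_nhds hz] with z hz
    rw [hP, hP]
    have : h z = 0 := hz
    simp only [hh] at this
    linear_combination this
  exfalso
  obtain ⟨n, u, hu, hu0, hnu⟩ := hha.exists_eventuallyEq_pow_smul_nonzero_iff.2 hz
  have key : ∀ᶠ z in 𝓝[≠] (0 : ℂ),
      (n * u z + z * deriv u z) * ((z ^ 3 * L.derivWeierstrassPExcept 0 z - 2) +
        (z ^ 3 * M.derivWeierstrassPExcept 0 z - 2)) =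
      u z * (4 * ((z ^ 2 * L.weierstrassPExcept 0 z + 1) ^ 2 +
        (z ^ 2 * L.weierstrassPExcept 0 z + 1) * (z ^ 2 * M.weierstrassPExcept 0 z + 1) +
        (z ^ 2 * M.weierstrassPExcept 0 z + 1) ^ 2) - L.g₂ * z ^ 4) := by
    filter_upwards [hmem L, hmem M, mem_nhdsWithin_of_mem_nhds hnu.eventually_nhds,
      mem_nhdsWithin_of_mem_nhds hu.eventually_analyticAt,
      mem_nhdsWithin_of_mem_nhds hP1.eventually_analyticAt,
      mem_nhdsWithin_of_mem_nhds hP2.eventually_analyticAt] with z hz hz' hnz huz h1z h2z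
    have hz0 := hz.1
    have e1 := L.derivWeierstrassP_sq z hz.2
    have e2 := M.derivWeierstrassP_sq z hz'.2
    have d1 : HasDerivAt h (L.derivWeierstrassP z - M.derivWeierstrassP z) z := by
      have a1 : HasDerivAt L.weierstrassP (L.derivWeierstrassP z) z := by
        rw [← deriv_weierstrassP]
        exact (L.analyticOnNhd_weierstrassP z hz.2).differentiableAt.hasDerivAt
      have a2 : HasDerivAt M.weierstrassP (M.derivWeierstrassP z) z := by
        rw [← deriv_weierstrassP]
        exact (M.analyticOnNhd_weierstrassP z hz'.2).differentiableAt.hasDerivAt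
      have := a1.sub a2
      convert! this using 1
      ext w
      simp [hh, hP]
    have d2 : HasDerivAt h (n * z ^ (n - 1) * u z + z ^ n * deriv u z) z := by
      have : HasDerivAt (fun z => z ^ n * u z) _ z :=
        (hasDerivAt_pow n z).mul huz.differentiableAt.hasDerivAt
      refine this.congr_of_eventuallyEq ?_
      filter_upwards [hnz] with w hw
      simpa using hw
    have d := d1.unique d2
    have hv : L.weierstrassP z - M.weierstrassP z = z ^ n * u z := by
      have := hnz.self_of_nhds
      simp only [sub_zero, smul_eq_mul, hh] at this
      rw [hP, hP, ← this]; ring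
    have dz : (L.derivWeierstrassP z - M.derivWeierstrassP z) * z =
        z ^ n * (n * u z + z * deriv u z) := by
      rw [d]
      rcases n with _ | n
      · simp; ring
      · simp only [Nat.add_sub_cancel]; ring
    have f1 : z ^ 3 * L.derivWeierstrassPExcept 0 z - 2 = z ^ 3 * L.derivWeierstrassP z := by
      rw [hQ]; field_simp
    have f2 : z ^ 3 * M.derivWeierstrassPExcept 0 z - 2 = z ^ 3 * M.derivWeierstrassP z := by
      rw [hQ]; field_simp
    have f3 : z ^ 2 * L.weierstrassPExcept 0 z + 1 = z ^ 2 * L.weierstrassP z := by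
      rw [hP]; field_simp
    have f4 : z ^ 2 * M.weierstrassPExcept 0 z + 1 = z ^ 2 * M.weierstrassP z := by
      rw [hP]; field_simp
    rw [f1, f2, f3, f4]
    apply mul_left_cancel₀ (pow_ne_zero n hz0)
    rw [← h2, ← h3] at e2
    rw [← mul_assoc, ← dz, ← mul_assoc, ← hv]
    linear_combination z ^ 4 * e1 - z ^ 4 * e2
  have hlim := tendsto_nhds_unique_of_eventuallyEq (l := 𝓝[≠] (0 : ℂ)) (a := (n * u 0) * (-4))
    (b := u 0 * 12) ?_ ?_ key
  · have : u 0 * ((n : ℂ) + 3) = 0 := by linear_combination -hlim / 4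
    rcases mul_eq_zero.1 this with h | h
    · exact hu0 h
    · norm_cast at h
  · have c : ContinuousAt (fun z => (n * u z + z * deriv u z) * ((z ^ 3 * L.derivWeierstrassPExcept 0 z - 2) +
        (z ^ 3 * M.derivWeierstrassPExcept 0 z - 2))) 0 := by
      have := hu.deriv
      apply AnalyticAt.continuousAt (𝕜 := ℂ)
      fun_prop
    convert! c.tendsto.mono_left nhdsWithin_le_nhds using 2
    norm_num
  · have c : ContinuousAt (fun z => u z * (4 * ((z ^ 2 * L.weierstrassPExcept 0 z + 1) ^ 2 +
        (z ^ 2 * L.weierstrassPExcept 0 z + 1) * (z ^ 2 * M.weierstrassPExcept 0 z + 1) +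
        (z ^ 2 * M.weierstrassPExcept 0 z + 1) ^ 2) - L.g₂ * z ^ 4)) 0 := by
      apply AnalyticAt.continuousAt (𝕜 := ℂ)
      fun_prop
    convert! c.tendsto.mono_left nhdsWithin_le_nhds using 2
    norm_num

lemma lattice_le_of_invariants (L M : PeriodPair) (h2 : L.g₂ = M.g₂) (h3 : L.g₃ = M.g₃) :
    L.lattice ≤ M.lattice := by
  intro l hl
  by_contra hlM
  have hmer : Meromorphic (L.weierstrassP - M.weierstrassP) :=
    L.meromorphic_weierstrassP.sub M.meromorphic_weierstrassP
  have h0 : meromorphicOrderAt (L.weierstrassP - M.weierstrassP) 0 = ⊤ := by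
    rw [meromorphicOrderAt_eq_top_iff]
    filter_upwards [eventually_weierstrassP_eq_of_invariants L M h2 h3] with z hz
    simp [hz]
  have h1 : meromorphicOrderAt (L.weierstrassP - M.weierstrassP) l = ⊤ := by
    by_contra h
    exact MeromorphicOn.meromorphicOrderAt_ne_top_of_isPreconnected (U := Set.univ)
      (fun z _ => hmer z) isPreconnected_univ (Set.mem_univ l) (Set.mem_univ 0) h h0
  rw [meromorphicOrderAt_eq_top_iff] at h1
  have h4 : L.weierstrassP =ᶠ[𝓝[≠] l] M.weierstrassP := by
    filter_upwards [h1] with z hz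
    exact sub_eq_zero.1 hz
  have h5 := meromorphicOrderAt_congr h4
  rw [L.order_weierstrassP l hl] at h5
  have h6 := (M.analyticOnNhd_weierstrassP l hlM).meromorphicOrderAt_nonneg
  rw [← h5] at h6
  exact absurd h6 (by decide)

noncomputable def scaledPeriodPair (c : ℂ) (hc : c ≠ 0) (τ : ℍ) : PeriodPair where
  ω₁ := c
  ω₂ := c * τ
  indep := by
    rw [LinearIndependent.pair_iff]
    intro s t h
    have h1 : c * (s + t * τ) = 0 := by
      simp only [Complex.real_smul] at h
      linear_combination h
    have h2 : (s : ℂ) + t * τ = 0 := (mul_eq_zero.1 h1).resolve_left hc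
    have h3 : t = 0 := by
      have := congrArg Complex.im h2
      simpa [τ.im_ne_zero] using this
    subst h3
    simpa using h2

lemma scaledPeriodPair_G (c : ℂ) (hc : c ≠ 0) (τ : ℍ) (n : ℕ) :
    (scaledPeriodPair c hc τ).G n = (c ^ n)⁻¹ * ∑' p : ℤ × ℤ, (((p.1 : ℂ) + (p.2 : ℂ) * τ) ^ n)⁻¹ := by
  rw [PeriodPair.G, ← (scaledPeriodPair c hc τ).latticeEquivProd.symm.toEquiv.tsum_eq, ← tsum_mul_left]
  congr 1
  ext p
  have := (scaledPeriodPair c hc τ).latticeEquiv_symm_apply p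
  simp only [LinearEquiv.coe_toEquiv]
  rw [this, ← mul_inv, ← mul_pow]
  congr 2
  simp only [scaledPeriodPair]
  ring

lemma scaledPeriodPair_g₂ (c : ℂ) (hc : c ≠ 0) (τ : ℍ) :
    (scaledPeriodPair c hc τ).g₂ = (c ^ 4)⁻¹ * g2 τ := by
  have : g2 τ = 60 * ∑' p : ℤ × ℤ, (((p.1 : ℂ) + (p.2 : ℂ) * τ) ^ 4)⁻¹ := by
    unfold g2
    congr 1
    apply tsum_congr
    intro p
    split_ifs with h <;> simp [h]
  rw [PeriodPair.g₂, scaledPeriodPair_G, this]; ring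

lemma scaledPeriodPair_g₃ (c : ℂ) (hc : c ≠ 0) (τ : ℍ) :
    (scaledPeriodPair c hc τ).g₃ = (c ^ 6)⁻¹ * g3 τ := by
  have : g3 τ = 140 * ∑' p : ℤ × ℤ, (((p.1 : ℂ) + (p.2 : ℂ) * τ) ^ 6)⁻¹ := by
    unfold g3
    congr 1
    apply tsum_congr
    intro p
    split_ifs with h <;> simp [h]
  rw [PeriodPair.g₃, scaledPeriodPair_G, this]; ring

lemma g2_cube_sub_ne_zero (τ : ℍ) : g2 τ ^ 3 - 27 * g3 τ ^ 2 ≠ 0 := by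
  have hd := ModularForm.discriminant_ne_zero τ
  rw [ModularForm.discriminant_eq_E₄_cube_sub_E₆_sq] at hd
  rw [g2_coe, g3_coe]
  intro h
  apply hd
  have hpi : (Real.pi : ℂ) ≠ 0 := by exact_mod_cast Real.pi_ne_zero
  have : (64 / 27 : ℂ) * Real.pi ^ 12 * (ModularForm.E₄ τ ^ 3 - ModularForm.E₆ τ ^ 2) = 0 := by linear_combination h
  rcases mul_eq_zero.1 this with h | h
  · simp [hpi] at h
  · rw [h]; simp

lemma exists_scaling_of_klein_eq (σ τ : ℍ) (h : klein σ = klein τ) :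
    ∃ c : ℂ, c ≠ 0 ∧ g2 τ = c ^ 4 * g2 σ ∧ g3 τ = c ^ 6 * g3 σ := by
  have hs := g2_cube_sub_ne_zero σ
  have ht := g2_cube_sub_ne_zero τ
  have hc : g2 σ ^ 3 * g3 τ ^ 2 = g2 τ ^ 3 * g3 σ ^ 2 := by
    rw [klein, klein, div_eq_div_iff hs ht] at h
    linear_combination -h / (1728 * 27)
  by_cases h2 : g2 σ = 0
  · have h3 : g3 σ ≠ 0 := fun h => hs (by rw [h, h2]; ring)
    have h2' : g2 τ = 0 := by
      rw [h2] at hc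
      have : g2 τ ^ 3 * g3 σ ^ 2 = 0 := by rw [← hc]; ring
      simpa [h3] using this
    have h3' : g3 τ ≠ 0 := fun h => ht (by rw [h, h2']; ring)
    obtain ⟨c, hc⟩ := IsAlgClosed.exists_pow_nat_eq (g3 τ / g3 σ) (n := 6) (by norm_num)
    refine ⟨c, ?_, by rw [h2, h2']; ring, by rw [hc]; field_simp⟩
    rintro rfl
    exact div_ne_zero h3' h3 (by rw [← hc]; simp)
  by_cases h3 : g3 σ = 0
  · have h3' : g3 τ = 0 := by
      rw [h3] at hc
      have : g2 σ ^ 3 * g3 τ ^ 2 = 0 := by rw [hc]; ring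
      simpa [h2] using this
    have h2' : g2 τ ≠ 0 := fun h => ht (by rw [h, h3']; ring)
    obtain ⟨c, hc⟩ := IsAlgClosed.exists_pow_nat_eq (g2 τ / g2 σ) (n := 4) (by norm_num)
    refine ⟨c, ?_, by rw [hc]; field_simp, by rw [h3, h3']; ring⟩
    rintro rfl
    exact div_ne_zero h2' h2 (by rw [← hc]; simp)
  have h2' : g2 τ ≠ 0 := by
    intro h
    have : g2 σ ^ 3 * g3 τ ^ 2 = 0 := by rw [hc, h]; ring
    have h3' : g3 τ = 0 := by simpa [h2] using this
    exact ht (by rw [h, h3']; ring)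
  have h3' : g3 τ ≠ 0 := by
    intro h
    have : g2 τ ^ 3 * g3 σ ^ 2 = 0 := by rw [← hc, h]; ring
    simp [h3, h2'] at this
  obtain ⟨c, hcc⟩ := IsAlgClosed.exists_pow_nat_eq (g3 τ * g2 σ / (g3 σ * g2 τ)) (n := 2) (by norm_num)
  refine ⟨c, ?_, ?_, ?_⟩
  · rintro rfl
    exact div_ne_zero (mul_ne_zero h3' h2) (mul_ne_zero h3 h2') (by rw [← hcc]; simp)
  · rw [show c ^ 4 = (c ^ 2) ^ 2 by ring, hcc]
    field_simp
    linear_combination -hc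
  · rw [show c ^ 6 = (c ^ 2) ^ 3 by ring, hcc]
    field_simp
    linear_combination -hc

lemma exists_specialLinearGroup (a b c d : ℤ) (h : a * d - b * c = 1) :
    ∃ γ : Matrix.SpecialLinearGroup (Fin 2) ℤ, γ 0 0 = a ∧ γ 0 1 = b ∧ γ 1 0 = c ∧ γ 1 1 = d :=
  ⟨⟨!![a, b; c, d], by rw [Matrix.det_fin_two_of, h]⟩, by simp⟩

lemma coe_smul_eq_div (γ : Matrix.SpecialLinearGroup (Fin 2) ℤ) (z : ℍ) :
    ((γ • z : ℍ) : ℂ) = ((γ 0 0 : ℂ) * z + (γ 0 1 : ℂ)) / ((γ 1 0 : ℂ) * z + (γ 1 1 : ℂ)) := by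
  rw [UpperHalfPlane.coe_specialLinearGroup_apply]
  simp

theorem exists_smul_eq_of_klein_eq (σ τ : ℍ) (h : klein σ = klein τ) :
    ∃ γ : Matrix.SpecialLinearGroup (Fin 2) ℤ, γ • σ = τ := by
  obtain ⟨c, hc, h2, h3⟩ := exists_scaling_of_klein_eq σ τ h
  have e2 : (scaledPeriodPair 1 one_ne_zero σ).g₂ = (scaledPeriodPair c hc τ).g₂ := by
    rw [scaledPeriodPair_g₂, scaledPeriodPair_g₂, h2]; field_simp
  have e3 : (scaledPeriodPair 1 one_ne_zero σ).g₃ = (scaledPeriodPair c hc τ).g₃ := by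
    rw [scaledPeriodPair_g₃, scaledPeriodPair_g₃, h3]; field_simp
  have hle := lattice_le_of_invariants _ _ e2 e3
  have hge := lattice_le_of_invariants _ _ e2.symm e3.symm
  obtain ⟨q, p, hpq⟩ := mem_lattice.1 (hge (ω₁_mem_lattice _))
  obtain ⟨b, a, hab⟩ := mem_lattice.1 (hge (ω₂_mem_lattice _))
  obtain ⟨q', p', hpq'⟩ := mem_lattice.1 (hle (ω₁_mem_lattice _))
  obtain ⟨b', a', hab'⟩ := mem_lattice.1 (hle (ω₂_mem_lattice _))
  simp only [scaledPeriodPair, one_mul, mul_one] at hpq hab hpq' hab'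
  have lin : ∀ m n : ℤ, (m : ℂ) + n * (τ : ℂ) = 0 → m = 0 ∧ n = 0 := by
    intro m n h
    have h3 : n = 0 := by
      have := congrArg Complex.im h
      simpa [τ.im_ne_zero] using this
    subst h3
    simpa using h
  have r1 := lin (p * b' + q * q' - 1) (p * a' + q * p') (by
    apply mul_left_cancel₀ hc
    push_cast
    linear_combination (p : ℂ) * hab' + q * hpq' + hpq)
  have r2 := lin (a * b' + b * q') (a * a' + b * p' - 1) (by
    apply mul_left_cancel₀ hc
    push_cast
    linear_combination (a : ℂ) * hab' + b * hpq' + hab)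
  have hdet2 : (a * q - b * p) * (a' * q' - b' * p') = 1 := by
    linear_combination (a * a' + b * p') * r1.1 + r2.2 - (p * a' + q * p') * r2.1
  have hden : (p : ℂ) * σ + q ≠ 0 := by
    intro h
    apply hc
    linear_combination h - hpq
  have hτ : (τ : ℂ) = (a * σ + b) / (p * σ + q) := by
    rw [eq_div_iff hden]
    apply mul_left_cancel₀ hc
    linear_combination (c * τ) * hpq - c * hab
  have hdet : a * q - b * p = 1 := by
    rcases Int.eq_one_or_neg_one_of_mul_eq_one hdet2 with h1 | h1
    · exact h1
    exfalso
    have him : (τ : ℂ).im * Complex.normSq (p * σ + q) = ((a * q - b * p : ℤ) : ℝ) * (σ : ℂ).im := by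
      have hn : Complex.normSq (p * σ + q) ≠ 0 := by simpa using hden
      have : (τ : ℂ) * (Complex.normSq (p * σ + q) : ℂ) = (a * σ + b) * (starRingEnd ℂ) (p * σ + q) := by
        rw [Complex.normSq_eq_conj_mul_self, hτ, div_mul_eq_mul_div, div_eq_iff hden]; ring
      have := congrArg Complex.im this
      simp at this
      simp only [Int.cast_sub, Int.cast_mul, UpperHalfPlane.coe_im] at *
      linear_combination this
    rw [h1] at him
    have h1 := τ.im_pos
    have h2 := σ.im_pos
    have h3 : 0 < Complex.normSq (p * σ + q) := by simpa using hden
    have := mul_pos h1 h3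
    push_cast at him
    simp only [UpperHalfPlane.coe_im] at him
    linarith
  obtain ⟨γ, rfl, rfl, rfl, rfl⟩ := exists_specialLinearGroup a b p q hdet
  refine ⟨γ, UpperHalfPlane.ext ?_⟩
  rw [coe_smul_eq_div, hτ]

end

section

open UpperHalfPlane

/-- The primitive upper triangular matrices `(a, b; 0, d)` of determinant `m` with `0 ≤ b < d`,
as triples `(a, b, d)`. -/
def heckeReps (m : ℕ) : Finset (ℕ × ℕ × ℕ) :=
  (Finset.range (m + 1) ×ˢ Finset.range (m + 1) ×ˢ Finset.range (m + 1)).filter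
    fun t => t.1 * t.2.2 = m ∧ t.2.1 < t.2.2 ∧ Nat.gcd (Nat.gcd t.1 t.2.1) t.2.2 = 1

lemma mem_heckeReps {m : ℕ} (hm : 0 < m) {t : ℕ × ℕ × ℕ} :
    t ∈ heckeReps m ↔ t.1 * t.2.2 = m ∧ t.2.1 < t.2.2 ∧ Nat.gcd (Nat.gcd t.1 t.2.1) t.2.2 = 1 := by
  simp only [heckeReps, Finset.mem_filter, Finset.mem_product, Finset.mem_range,
    and_iff_right_iff_imp]
  rintro ⟨h1, h2, -⟩
  have h3 : t.1 ≤ m := Nat.le_of_dvd hm ⟨_, h1.symm⟩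
  have h4 : t.2.2 ≤ m := Nat.le_of_dvd hm ⟨t.1, by rw [← h1, mul_comm]⟩
  omega

lemma heckeReps_pos {m : ℕ} (hm : 0 < m) {t : ℕ × ℕ × ℕ} (ht : t ∈ heckeReps m) :
    0 < t.1 ∧ 0 < t.2.2 := by
  have := ((mem_heckeReps hm).1 ht).1
  constructor <;> refine Nat.pos_of_ne_zero fun h => ?_ <;> simp [h] at this <;> omega

lemma exists_heckeRep {m : ℕ} (hm : 0 < m) (A B C D : ℤ) (hdet : A * D - B * C = m)
    (hprim : ∀ k : ℤ, k ∣ A → k ∣ B → k ∣ C → k ∣ D → IsUnit k) :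
    ∃ t ∈ heckeReps m, ∃ p q r s : ℤ, p * s - q * r = 1 ∧
      A = p * t.1 ∧ B = p * t.2.1 + q * t.2.2 ∧ C = r * t.1 ∧ D = r * t.2.1 + s * t.2.2 := by
  have hg : 0 < Int.gcd A C := by
    refine Nat.pos_of_ne_zero fun h => ?_
    rw [Int.gcd_eq_zero_iff] at h
    rw [h.1, h.2] at hdet
    simp at hdet
    omega
  obtain ⟨A', C', hcop, hA, hC⟩ := Int.exists_gcd_one hg
  set e := Int.gcd A C with he
  obtain ⟨u, v, huv⟩ := Int.isCoprime_iff_gcd_eq_one.2 hcop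
  have hd : (e : ℤ) * (A' * D - C' * B) = m := by
    rw [hA, hC] at hdet; linear_combination hdet
  have hdpos : 0 < A' * D - C' * B := by
    have : (0 : ℤ) < e * (A' * D - C' * B) := by rw [hd]; exact_mod_cast hm
    exact pos_of_mul_pos_right this (by positivity)
  obtain ⟨d, hdd⟩ := Int.eq_ofNat_of_zero_le hdpos.le
  set b0 := u * B + v * D with hb0
  have hd0 : (d : ℤ) ≠ 0 := by rw [← hdd]; exact hdpos.ne'
  obtain ⟨b, hb⟩ := Int.eq_ofNat_of_zero_le (Int.emod_nonneg b0 hd0)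
  have hbd : b < d := by
    have := Int.emod_lt_of_pos b0 (by omega : (0 : ℤ) < d)
    omega
  have hb0' : b0 = b + d * (b0 / d) := by rw [← hb]; exact (Int.emod_add_mul_ediv b0 d).symm
  have eqB : B = A' * b + (A' * (b0 / d) - v) * d := by
    have : B = A' * b0 - v * d := by rw [← hdd, hb0]; linear_combination (-B) * huv
    rw [this]; nth_rw 1 [hb0']; ring
  have eqD : D = C' * b + (C' * (b0 / d) + u) * d := by
    have : D = C' * b0 + u * d := by rw [← hdd, hb0]; linear_combination (-D) * huv
    rw [this]; nth_rw 1 [hb0']; ring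
  refine ⟨(e, b, d), (mem_heckeReps hm).2 ⟨?_, hbd, ?_⟩, A', A' * (b0 / d) - v, C',
    C' * (b0 / d) + u, by linear_combination huv, hA, eqB, hC, eqD⟩
  · have := hd; rw [hdd] at this; exact_mod_cast this
  · set k := Nat.gcd (Nat.gcd e b) d with hk
    have k1 : (k : ℤ) ∣ e := Int.natCast_dvd_natCast.2 ((Nat.gcd_dvd_left _ _).trans (Nat.gcd_dvd_left _ _))
    have k2 : (k : ℤ) ∣ b := Int.natCast_dvd_natCast.2 ((Nat.gcd_dvd_left _ _).trans (Nat.gcd_dvd_right _ _))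
    have k3 : (k : ℤ) ∣ d := Int.natCast_dvd_natCast.2 (Nat.gcd_dvd_right _ _)
    have := hprim k (hA ▸ k1.mul_left _) (eqB ▸ (k2.mul_left _).add (k3.mul_left _))
      (hC ▸ k1.mul_left _) (eqD ▸ (k2.mul_left _).add (k3.mul_left _))
    simpa [Int.isUnit_iff_natAbs_eq] using this

lemma heckeRep_unique {m : ℕ} (hm : 0 < m) {t t' : ℕ × ℕ × ℕ} (ht : t ∈ heckeReps m)
    (ht' : t' ∈ heckeReps m) {p q r s : ℤ} (hdet : p * s - q * r = 1) (h1 : (t.1 : ℤ) = p * t'.1)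
    (h2 : (t.2.1 : ℤ) = p * t'.2.1 + q * t'.2.2) (h3 : 0 = r * (t'.1 : ℤ))
    (h4 : (t.2.2 : ℤ) = r * t'.2.1 + s * t'.2.2) : t = t' := by
  have a1 := heckeReps_pos hm ht
  have a2 := heckeReps_pos hm ht'
  have b1 := ((mem_heckeReps hm).1 ht).2.1
  have b2 := ((mem_heckeReps hm).1 ht').2.1
  have hr : r = 0 := by
    rcases mul_eq_zero.1 h3.symm with h | h
    · exact h
    · omega
  subst hr
  have hps : p * s = 1 := by linear_combination hdet
  have hp : p = 1 := by
    rcases Int.eq_one_or_neg_one_of_mul_eq_one hps with h | h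
    · exact h
    · rw [h] at h1; omega
  subst hp
  have hs : s = 1 := by linarith
  subst hs
  obtain ⟨a, b, d⟩ := t
  obtain ⟨a', b', d'⟩ := t'
  simp only at *
  have ha : a = a' := by omega
  have hd : d = d' := by omega
  subst ha hd
  have hq : q = 0 := by
    by_contra hq
    rcases lt_or_gt_of_ne hq with h | h
    · have : q * (d : ℤ) ≤ -1 * d := mul_le_mul_of_nonneg_right (by omega) (by omega)
      omega
    · have : 1 * (d : ℤ) ≤ q * d := mul_le_mul_of_nonneg_right (by omega) (by omega)
      omega
  subst hq
  have : b = b' := by omega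
  rw [this]

/-- `τ ↦ (a τ + b) / d` as a self-map of the upper half-plane. -/
noncomputable def affineMap (a b d : ℕ) (ha : 0 < a) (hd : 0 < d) (τ : ℍ) : ℍ :=
  ⟨((a : ℂ) * τ + b) / d, by
    rw [Complex.div_natCast_im]
    have := τ.im_pos
    have : 0 < (a : ℝ) * τ.im := by positivity
    simpa using div_pos this (by exact_mod_cast hd)⟩

/-- The function `τ ↦ j((a τ + b) / d)`. -/
noncomputable def kleinAt (t : ℕ × ℕ × ℕ) (τ : ℍ) : ℂ := klein (((t.1 : ℂ) * τ + t.2.1) / t.2.2)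

lemma kleinAt_eq (a b d : ℕ) (ha : 0 < a) (hd : 0 < d) (τ : ℍ) :
    kleinAt (a, b, d) τ = klein (affineMap a b d ha hd τ) := rfl

lemma klein_div_eq_kleinAt {A B C D p q r s : ℤ} {t : ℕ × ℕ × ℕ} (ht : 0 < t.1 ∧ 0 < t.2.2)
    (hdet : p * s - q * r = 1)
    (hA : A = p * t.1) (hB : B = p * t.2.1 + q * t.2.2) (hC : C = r * t.1)
    (hD : D = r * t.2.1 + s * t.2.2) (τ : ℍ) :
    klein (((A : ℂ) * τ + B) / ((C : ℂ) * τ + D)) = kleinAt t τ := by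
  obtain ⟨γ, rfl, rfl, rfl, rfl⟩ := exists_specialLinearGroup p q r s hdet
  obtain ⟨a, b, d⟩ := t
  rw [kleinAt_eq a b d ht.1 ht.2, ← klein_smul γ, coe_smul_eq_div]
  have hd : (d : ℂ) ≠ 0 := by exact_mod_cast ht.2.ne'
  congr 1
  rw [← mul_div_mul_right _ ((γ 1 0 : ℂ) * (affineMap a b d ht.1 ht.2 τ : ℍ) + (γ 1 1 : ℂ)) hd]
  subst hA hB hC hD
  simp only [affineMap]
  push_cast
  congr 1 <;> field_simp <;> ring

lemma exists_kleinAt_smul {m : ℕ} (hm : 0 < m) (γ : Matrix.SpecialLinearGroup (Fin 2) ℤ)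
    (t : ℕ × ℕ × ℕ) (ht : t ∈ heckeReps m) :
    ∃ t' ∈ heckeReps m, (∀ τ : ℍ, kleinAt t (γ • τ) = kleinAt t' τ) ∧
      ∃ p q r s : ℤ, p * s - q * r = 1 ∧ t.1 * γ 0 0 + t.2.1 * γ 1 0 = p * t'.1 ∧
      t.1 * γ 0 1 + t.2.1 * γ 1 1 = p * t'.2.1 + q * t'.2.2 ∧
      t.2.2 * γ 1 0 = r * t'.1 ∧ t.2.2 * γ 1 1 = r * t'.2.1 + s * t'.2.2 := by
  have hγ : γ 0 0 * γ 1 1 - γ 0 1 * γ 1 0 = 1 := by rw [← Matrix.det_fin_two]; exact γ.2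
  have ht2 := (mem_heckeReps hm).1 ht
  obtain ⟨t', ht', p, q, r, s, h0, h1, h2, h3, h4⟩ := exists_heckeRep hm (t.1 * γ 0 0 + t.2.1 * γ 1 0)
    (t.1 * γ 0 1 + t.2.1 * γ 1 1) (t.2.2 * γ 1 0) (t.2.2 * γ 1 1) (by
      have : (t.1 : ℤ) * t.2.2 = m := by exact_mod_cast ht2.1
      linear_combination (t.1 : ℤ) * t.2.2 * hγ + this) (by
      intro k k1 k2 k3 k4
      have l1 : k ∣ (t.1 : ℤ) := by
        have := (k1.mul_right (γ 1 1)).sub (k2.mul_right (γ 1 0))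
        rwa [show (t.1 * γ 0 0 + t.2.1 * γ 1 0) * γ 1 1 - (t.1 * γ 0 1 + t.2.1 * γ 1 1) * γ 1 0 =
          (t.1 : ℤ) by linear_combination (t.1 : ℤ) * hγ] at this
      have l2 : k ∣ (t.2.1 : ℤ) := by
        have := (k2.mul_right (γ 0 0)).sub (k1.mul_right (γ 0 1))
        rwa [show (t.1 * γ 0 1 + t.2.1 * γ 1 1) * γ 0 0 - (t.1 * γ 0 0 + t.2.1 * γ 1 0) * γ 0 1 =
          (t.2.1 : ℤ) by linear_combination (t.2.1 : ℤ) * hγ] at this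
      have l3 : k ∣ (t.2.2 : ℤ) := by
        have := (k4.mul_right (γ 0 0)).sub (k3.mul_right (γ 0 1))
        rwa [show (t.2.2 * γ 1 1) * γ 0 0 - (t.2.2 * γ 1 0) * γ 0 1 =
          (t.2.2 : ℤ) by linear_combination (t.2.2 : ℤ) * hγ] at this
      have := Nat.dvd_gcd (Nat.dvd_gcd (Int.natAbs_dvd_natAbs.2 l1) (Int.natAbs_dvd_natAbs.2 l2))
        (Int.natAbs_dvd_natAbs.2 l3)
      simp only [Int.natAbs_natCast, ht2.2.2, Nat.dvd_one] at this
      exact Int.isUnit_iff_natAbs_eq.2 this)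
  refine ⟨t', ht', fun τ => ?_, p, q, r, s, h0, h1, h2, h3, h4⟩
  rw [← klein_div_eq_kleinAt (heckeReps_pos hm ht') h0 h1 h2 h3 h4, kleinAt, coe_smul_eq_div]
  congr 1
  have hne : (γ 1 0 : ℂ) * τ + (γ 1 1 : ℂ) ≠ 0 := by
    intro h
    have h1 : γ 1 0 = 0 := by
      have := congrArg Complex.im h
      simpa [τ.im_ne_zero] using this
    rw [h1] at h hγ
    have h2 : γ 1 1 = 0 := by simpa using h
    rw [h2] at hγ
    simp at hγ
  have hd : (t.2.2 : ℂ) ≠ 0 := by exact_mod_cast (heckeReps_pos hm ht).2.ne'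
  have hne2 : ((t.2.2 * γ 1 0 : ℤ) : ℂ) * τ + ((t.2.2 * γ 1 1 : ℤ) : ℂ) ≠ 0 := by
    push_cast
    intro h
    apply mul_ne_zero hd hne
    linear_combination h
  rw [div_eq_div_iff hd hne2, mul_div_assoc', div_add' _ _ _ hne, div_mul_eq_mul_div, div_eq_iff hne]
  push_cast
  ring

lemma prod_kleinAt_smul {m : ℕ} (hm : 0 < m) (γ : Matrix.SpecialLinearGroup (Fin 2) ℤ)
    (Φ : ℂ → ℂ) (τ : ℍ) :
    ∏ t ∈ heckeReps m, Φ (kleinAt t (γ • τ)) = ∏ t ∈ heckeReps m, Φ (kleinAt t τ) := by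
  have hγ : γ 0 0 * γ 1 1 - γ 0 1 * γ 1 0 = 1 := by rw [← Matrix.det_fin_two]; exact γ.2
  choose! f hf hfk p q r s hdet e1 e2 e3 e4 using exists_kleinAt_smul hm γ
  have hmaps : Set.MapsTo f (heckeReps m) (heckeReps m) := fun t ht => hf t ht
  have hinj : Set.InjOn f (heckeReps m) := by
    intro t ht u hu htu
    have a1 := e1 t ht
    have a2 := e2 t ht
    have a3 := e3 t ht
    have a4 := e4 t ht
    have b1 := e1 u hu
    have b2 := e2 u hu
    have b3 := e3 u hu
    have b4 := e4 u hu
    have d1 := hdet t ht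
    have d2 := hdet u hu
    rw [htu] at a1 a2 a3 a4
    have k1 : (t.1 * γ 0 0 + t.2.1 * γ 1 0 : ℤ) = (p t * s u - q t * r u) * (u.1 * γ 0 0 + u.2.1 * γ 1 0) +
        (q t * p u - p t * q u) * (u.2.2 * γ 1 0) := by
      rw [a1, b1, b3]; linear_combination (-p t * (f u).1) * d2
    have k2 : (t.1 * γ 0 1 + t.2.1 * γ 1 1 : ℤ) = (p t * s u - q t * r u) * (u.1 * γ 0 1 + u.2.1 * γ 1 1) +
        (q t * p u - p t * q u) * (u.2.2 * γ 1 1) := by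
      rw [a2, b2, b4]; linear_combination (-p t * (f u).2.1 - q t * (f u).2.2) * d2
    have k3 : (t.2.2 * γ 1 0 : ℤ) = (r t * s u - s t * r u) * (u.1 * γ 0 0 + u.2.1 * γ 1 0) +
        (s t * p u - r t * q u) * (u.2.2 * γ 1 0) := by
      rw [a3, b1, b3]; linear_combination (-r t * (f u).1) * d2
    have k4 : (t.2.2 * γ 1 1 : ℤ) = (r t * s u - s t * r u) * (u.1 * γ 0 1 + u.2.1 * γ 1 1) +
        (s t * p u - r t * q u) * (u.2.2 * γ 1 1) := by
      rw [a4, b2, b4]; linear_combination (-r t * (f u).2.1 - s t * (f u).2.2) * d2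
    refine heckeRep_unique hm ht hu (p := p t * s u - q t * r u) (q := q t * p u - p t * q u)
      (r := r t * s u - s t * r u) (s := s t * p u - r t * q u) ?_ ?_ ?_ ?_ ?_
    · linear_combination (p u * s u - q u * r u) * d1 + d2
    · linear_combination γ 1 1 * k1 - γ 1 0 * k2 - (t.1 - (p t * s u - q t * r u) * u.1) * hγ
    · linear_combination γ 0 0 * k2 - γ 0 1 * k1 - (t.2.1 - (p t * s u - q t * r u) * u.2.1 -
        (q t * p u - p t * q u) * u.2.2) * hγ
    · linear_combination γ 1 1 * k3 - γ 1 0 * k4 + ((r t * s u - s t * r u) * u.1) * hγ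
    · linear_combination γ 0 0 * k4 - γ 0 1 * k3 - (t.2.2 - (r t * s u - s t * r u) * u.2.1 -
        (s t * p u - r t * q u) * u.2.2) * hγ
  have hsurj := Finset.surjOn_of_injOn_of_card_le f hmaps hinj le_rfl
  refine Finset.prod_nbij f hmaps hinj hsurj fun t ht => ?_
  rw [hfk t ht]

end

section

open UpperHalfPlane PowerSeries
open scoped Manifold

/-- The integral power series `q j(q)`. -/
noncomputable def kleinSeries : PowerSeries ℤ := exists_hasExp_klein.choose

/-- The series `ξ • B (ζ t ^ k)`, where `B = q j(q)`. -/
noncomputable def kleinExp {K : Type*} [CommRing K] (k : ℕ) (hk : k ≠ 0) (ζ ξ : K) : PowerSeries K :=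
  C ξ * expand k hk (rescale ζ (kleinSeries.map (Int.castRingHom K)))

lemma kleinExp_map {K L : Type*} [CommRing K] [CommRing L] (φ : K →+* L) (k : ℕ) (hk : k ≠ 0)
    (ζ ξ : K) : (kleinExp k hk ζ ξ).map φ = kleinExp k hk (φ ζ) (φ ξ) := by
  ext n
  rw [kleinExp, kleinExp, coeff_map, coeff_C_mul, coeff_C_mul, coeff_expand, coeff_expand]
  split_ifs <;> simp [coeff_rescale]

lemma coeff_zero_kleinExp {K : Type*} [CommRing K] (k : ℕ) (hk : k ≠ 0) (ζ ξ : K) :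
    coeff 0 (kleinExp k hk ζ ξ) = ξ := by
  have h : constantCoeff kleinSeries = 1 := exists_hasExp_klein.choose_spec.1
  rw [kleinExp, coeff_C_mul, coeff_zero_eq_constantCoeff_apply, constantCoeff_expand,
    ← coeff_zero_eq_constantCoeff_apply, coeff_rescale, coeff_map,
    coeff_zero_eq_constantCoeff_apply, h]
  simp

lemma hasExp_klein_comp {z : ℍ → ℍ} {h k : ℕ} (hk : k ≠ 0) {ζ : ℂ} (hζ : ζ ≠ 0)
    (hz : ∀ τ : ℍ, Function.Periodic.qParam (1 : ℕ) (z τ) =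
      ζ * Function.Periodic.qParam h τ ^ k) :
    HasExp h (fun τ => klein (z τ)) k (kleinExp k hk ζ ζ⁻¹) := by
  have := exists_hasExp_klein.choose_spec.2.comp hk hζ hz
  rw [one_mul, pow_one] at this
  convert! this using 1

lemma hasExp_klein {m : ℕ} (hm : 0 < m) :
    HasExp m (fun τ : ℍ => klein τ) m (kleinExp m hm.ne' 1 1) := by
  have := hasExp_klein_comp (z := id) hm.ne' one_ne_zero (fun τ => qParam_one_eq_pow hm τ)
  rwa [inv_one] at this

lemma hasExp_kleinAt {m a b d : ℕ} (hm : a * d = m) (ha : 0 < a) (hd : 0 < d) :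
    HasExp m (kleinAt (a, b, d)) (a ^ 2)
      (kleinExp (a ^ 2) (by positivity) (Complex.exp (2 * Real.pi * Complex.I / m) ^ (a * b))
        (Complex.exp (2 * Real.pi * Complex.I / m) ^ (a * b))⁻¹) := by
  have := hasExp_klein_comp (z := affineMap a b d ha hd) (h := m) (k := a ^ 2) (by positivity)
    (ζ := Complex.exp (2 * Real.pi * Complex.I / m) ^ (a * b))
    (pow_ne_zero _ (Complex.exp_ne_zero _)) (fun τ => by
      rw [Function.Periodic.qParam, Function.Periodic.qParam, ← Complex.exp_nat_mul,
        ← Complex.exp_nat_mul, ← Complex.exp_add]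
      congr 1
      have ha' : (a : ℂ) ≠ 0 := by exact_mod_cast ha.ne'
      have hd' : (d : ℂ) ≠ 0 := by exact_mod_cast hd.ne'
      rw [← hm, affineMap]
      push_cast
      field_simp
      ring)
  exact this

lemma mdifferentiable_kleinAt {t : ℕ × ℕ × ℕ} (ht : 0 < t.1 ∧ 0 < t.2.2) :
    MDifferentiable 𝓘(ℂ) 𝓘(ℂ) (kleinAt t) := by
  have h := mdifferentiable_klein
  rw [UpperHalfPlane.mdifferentiable_iff] at h ⊢
  have hmaps : Set.MapsTo (fun z : ℂ => ((t.1 : ℂ) * z + t.2.1) / t.2.2) {z | 0 < z.im}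
      {z | 0 < z.im} := fun z hz => by
    exact (affineMap t.1 t.2.1 t.2.2 ht.1 ht.2 ⟨z, hz⟩).im_pos
  have h2 : DifferentiableOn ℂ (fun z : ℂ => ((t.1 : ℂ) * z + t.2.1) / t.2.2) {z | 0 < z.im} := by
    fun_prop
  refine (h.comp h2 hmaps).congr fun z hz => ?_
  have := hmaps hz
  simp only [Function.comp]
  rw [UpperHalfPlane.ofComplex_apply_of_im_pos hz, UpperHalfPlane.ofComplex_apply_of_im_pos this]
  rfl

lemma mdifferentiable_prod {ι : Type*} (s : Finset ι) (f : ι → ℍ → ℂ)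
    (h : ∀ i ∈ s, MDifferentiable 𝓘(ℂ) 𝓘(ℂ) (f i)) :
    MDifferentiable 𝓘(ℂ) 𝓘(ℂ) (fun τ => ∏ i ∈ s, f i τ) := by
  simp only [UpperHalfPlane.mdifferentiable_iff] at h ⊢
  exact DifferentiableOn.fun_finsetProd h

lemma mdifferentiable_sub' {f g : ℍ → ℂ} (hf : MDifferentiable 𝓘(ℂ) 𝓘(ℂ) f)
    (hg : MDifferentiable 𝓘(ℂ) 𝓘(ℂ) g) : MDifferentiable 𝓘(ℂ) 𝓘(ℂ) (fun τ => f τ - g τ) :=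
  hf.sub hg

lemma HasExp.prod {ι : Type*} {h : ℕ} (s : Finset ι) {f : ι → ℍ → ℂ} {N : ι → ℕ}
    {A : ι → PowerSeries ℂ} (H : ∀ i ∈ s, HasExp h (f i) (N i) (A i)) :
    HasExp h (fun τ => ∏ i ∈ s, f i τ) (∑ i ∈ s, N i) (∏ i ∈ s, A i) := by
  classical
  induction s using Finset.induction_on with
  | empty => simpa using HasExp.const h 1
  | insert i s hi ih =>
    simp only [Finset.prod_insert hi, Finset.sum_insert hi]
    exact (H i (Finset.mem_insert_self _ _)).mul (ih fun j hj => H j (Finset.mem_insert_of_mem hj))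

lemma HasExp.sub {h : ℕ} {f g : ℍ → ℂ} {N : ℕ} {A B : PowerSeries ℂ} (hA : HasExp h f N A)
    (hB : HasExp h g N B) : HasExp h (fun τ => f τ - g τ) N (A - B) := by
  have := hA.add hB.neg
  rw [← sub_eq_add_neg] at this
  convert! this using 1

/-- `f` has an expansion with algebraic integer coefficients whose leading coefficient is a unit. -/
def UnitExp (h : ℕ) (f : ℍ → ℂ) : Prop :=
  ∃ N A, HasExp h f N A ∧ (∀ n, IsIntegral ℤ (coeff n A)) ∧ coeff 0 A ≠ 0 ∧
    IsIntegral ℤ (coeff 0 A)⁻¹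

lemma UnitExp.mul {h : ℕ} {f g : ℍ → ℂ} (hf : UnitExp h f) (hg : UnitExp h g) :
    UnitExp h (f * g) := by
  obtain ⟨N, A, h1, h2, h3, h4⟩ := hf
  obtain ⟨M, B, g1, g2, g3, g4⟩ := hg
  have e : coeff 0 (A * B) = coeff 0 A * coeff 0 B := by simp
  refine ⟨_, _, h1.mul g1, fun n => ?_, ?_, ?_⟩
  · rw [coeff_mul]
    exact IsIntegral.sum _ fun i _ => (h2 _).mul (g2 _)
  · rw [e]; exact mul_ne_zero h3 g3
  · rw [e, mul_inv]; exact h4.mul g4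

lemma UnitExp.prod {ι : Type*} {h : ℕ} (s : Finset ι) {f : ι → ℍ → ℂ}
    (H : ∀ i ∈ s, UnitExp h (f i)) : UnitExp h (fun τ => ∏ i ∈ s, f i τ) := by
  classical
  induction s using Finset.induction_on with
  | empty =>
    refine ⟨0, C 1, by simpa using HasExp.const h 1, fun n => ?_, by simp, by
      simpa using! isIntegral_one⟩
    rw [coeff_C]
    split_ifs
    · exact isIntegral_one
    · exact isIntegral_zero
  | insert i s hi ih =>
    simp only [Finset.prod_insert hi]
    exact (H i (Finset.mem_insert_self _ _)).mul (ih fun j hj => H j (Finset.mem_insert_of_mem hj))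

lemma isIntegral_coeff_kleinExp {k : ℕ} (hk : k ≠ 0) {ζ ξ : ℂ} (hζ : IsIntegral ℤ ζ)
    (hξ : IsIntegral ℤ ξ) (n : ℕ) : IsIntegral ℤ (coeff n (kleinExp k hk ζ ξ)) := by
  have := kleinExp_map (algebraMap (integralClosure ℤ ℂ) ℂ) k hk ⟨ζ, hζ⟩ ⟨ξ, hξ⟩
  have h2 : coeff n (kleinExp k hk ζ ξ) = _ := (congrArg (coeff n) this).symm
  rw [h2, coeff_map]
  exact (coeff n _ : integralClosure ℤ ℂ).2

lemma isIntegral_exp_pow (m : ℕ) (hm : 0 < m) (k : ℕ) :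
    IsIntegral ℤ (Complex.exp (2 * Real.pi * Complex.I / m) ^ k) ∧
    IsIntegral ℤ (Complex.exp (2 * Real.pi * Complex.I / m) ^ k)⁻¹ := by
  have h := Complex.isPrimitiveRoot_exp m hm.ne'
  refine ⟨(h.isIntegral hm).pow k, ?_⟩
  rw [← inv_pow]
  exact (h.inv.isIntegral hm).pow k

lemma unitExp_klein_sub_kleinAt {m : ℕ} (hm : 0 < m) (hsq : ∀ a : ℕ, a ^ 2 ≠ m) {t : ℕ × ℕ × ℕ}
    (ht : t ∈ heckeReps m) : UnitExp m (fun τ => klein τ - kleinAt t τ) := by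
  obtain ⟨a, b, d⟩ := t
  obtain ⟨ha, hd⟩ := heckeReps_pos hm ht
  have had := ((mem_heckeReps hm).1 ht).1
  simp only at ha hd had
  have e1 := hasExp_klein hm
  have e2 := hasExp_kleinAt (b := b) had ha hd
  set ω := Complex.exp (2 * Real.pi * Complex.I / m) ^ (a * b) with hω
  have hω0 : ω ≠ 0 := pow_ne_zero _ (Complex.exp_ne_zero _)
  obtain ⟨i1, i2⟩ := isIntegral_exp_pow m hm (a * b)
  rw [← hω] at i1 i2
  have hX : ∀ (k : ℕ) (A : PowerSeries ℂ), (∀ n, IsIntegral ℤ (coeff n A)) →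
      ∀ n, IsIntegral ℤ (coeff n (X ^ k * A)) := fun k A hA n => by
    rw [coeff_X_pow_mul']
    split_ifs
    · exact hA _
    · exact isIntegral_zero
  have hX0 : ∀ (k : ℕ) (A : PowerSeries ℂ), 0 < k → coeff 0 (X ^ k * A) = 0 := fun k A hk => by
    rw [coeff_X_pow_mul', if_neg (by omega)]
  have j1 := fun n => isIntegral_coeff_kleinExp hm.ne' (ζ := 1) isIntegral_one isIntegral_one n
  have j2 := fun n => isIntegral_coeff_kleinExp (k := a ^ 2) (by positivity) i1 i2 n
  rcases lt_or_gt_of_ne (hsq a) with hlt | hlt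
  · have e3 := e2.shift (m - a ^ 2)
    rw [Nat.add_sub_cancel' hlt.le] at e3
    have hc : coeff 0 (kleinExp m hm.ne' 1 1 - X ^ (m - a ^ 2) * kleinExp (a ^ 2) (by positivity) ω ω⁻¹)
        = 1 := by
      rw [map_sub, hX0 _ _ (by omega), coeff_zero_kleinExp, sub_zero]
    refine ⟨_, _, e1.sub e3, fun n => ?_, ?_, ?_⟩
    · rw [map_sub]
      exact (j1 n).sub (hX _ _ j2 n)
    · rw [hc]; exact one_ne_zero
    · rw [hc, inv_one]; exact isIntegral_one
  · have e3 := e1.shift (a ^ 2 - m)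
    rw [Nat.add_sub_cancel' hlt.le] at e3
    have hc : coeff 0 (X ^ (a ^ 2 - m) * kleinExp m hm.ne' 1 1 - kleinExp (a ^ 2) (by positivity) ω ω⁻¹)
        = -ω⁻¹ := by
      rw [map_sub, hX0 _ _ (by omega), coeff_zero_kleinExp, zero_sub]
    refine ⟨_, _, e3.sub e2, fun n => ?_, ?_, ?_⟩
    · rw [map_sub]
      exact (hX _ _ j1 n).sub (j2 n)
    · rw [hc]; exact neg_ne_zero.2 (inv_ne_zero hω0)
    · rw [hc, inv_neg, inv_inv]; exact i1.neg

/-- The product `∏ (j(τ) - j(tτ))` over primitive matrices of determinant `m`. -/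
noncomputable def heckeProd (m : ℕ) (τ : ℍ) : ℂ := ∏ t ∈ heckeReps m, (klein τ - kleinAt t τ)

lemma heckeProd_smul {m : ℕ} (hm : 0 < m) (γ : Matrix.SpecialLinearGroup (Fin 2) ℤ) (τ : ℍ) :
    heckeProd m (γ • τ) = heckeProd m τ := by
  rw [heckeProd, heckeProd, klein_smul, prod_kleinAt_smul hm γ (fun x => klein τ - x)]

lemma mdifferentiable_heckeProd {m : ℕ} (hm : 0 < m) :
    MDifferentiable 𝓘(ℂ) 𝓘(ℂ) (heckeProd m) :=
  mdifferentiable_prod _ _ fun _ ht =>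
    mdifferentiable_sub' mdifferentiable_klein (mdifferentiable_kleinAt (heckeReps_pos hm ht))

lemma isIntegral_klein_of_heckeProd_eq_zero {m : ℕ} (hm : 0 < m) (hsq : ∀ a : ℕ, a ^ 2 ≠ m) {τ : ℍ}
    (h : heckeProd m τ = 0) : IsIntegral ℤ (klein τ) := by
  obtain ⟨N, A, hA, hI, h0, hinv⟩ : UnitExp m (heckeProd m) :=
    UnitExp.prod _ fun t ht => unitExp_klein_sub_kleinAt hm hsq ht
  obtain ⟨M, rfl⟩ := hA.dvd_of_invariant hm (fun γ z => heckeProd_smul hm γ z) h0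
  obtain ⟨P, hP, hPev, hdeg, hlead⟩ := exists_polynomial_klein
    (integralClosure ℤ ℂ).toSubring.toAddSubgroup hm _ _ A (fun γ z => heckeProd_smul hm γ z)
    (mdifferentiable_heckeProd hm) hA hI
  have hdeg' : P.natDegree ≤ M := Nat.le_of_mul_le_mul_left hdeg hm
  have hM := hlead M rfl
  set R := integralClosure ℤ ℂ
  have hQ : ∀ n, IsIntegral ℤ ((Polynomial.C (coeff 0 A)⁻¹ * P).coeff n) := fun n => by
    rw [Polynomial.coeff_C_mul]
    exact hinv.mul (hP n)
  have hlift : Polynomial.C (coeff 0 A)⁻¹ * P ∈ Polynomial.lifts (algebraMap R ℂ) := by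
    rw [Polynomial.lifts_iff_coeff_lifts]
    exact fun n => ⟨⟨_, hQ n⟩, rfl⟩
  have hmonic : (Polynomial.C (coeff 0 A)⁻¹ * P).Monic := by
    refine Polynomial.monic_of_natDegree_le_of_coeff_eq_one M
      ((Polynomial.natDegree_C_mul_le _ _).trans hdeg') ?_
    rw [Polynomial.coeff_C_mul, hM, inv_mul_cancel₀ h0]
  obtain ⟨Q, hQmap, -, hQmonic⟩ := Polynomial.lifts_and_degree_eq_and_monic hlift hmonic
  have : IsIntegral R (klein τ) := by
    refine ⟨Q, hQmonic, ?_⟩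
    rw [← Polynomial.eval_map, hQmap, Polynomial.eval_mul, ← hPev, h, mul_zero]
  exact isIntegral_trans (R := ℤ) (A := R) _ this

end

section

open UpperHalfPlane PowerSeries
open scoped Manifold

lemma expand_map_intCast_eq_pow {p : ℕ} [Fact p.Prime] {K : Type*} [CommRing K] [CharP K p]
    (A : PowerSeries ℤ) : expand p (Nat.Prime.ne_zero Fact.out) (A.map (Int.castRingHom K)) =
      A.map (Int.castRingHom K) ^ p := by
  have hp := (Fact.out : p.Prime).ne_zero
  have key : ∀ B : PowerSeries (ZMod p), expand p hp B = B ^ p := fun B => by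
    have := MvPowerSeries.map_frobenius_expand (R := ZMod p) p (f := B) hp
    rw [ZMod.frobenius_zmod, MvPowerSeries.map_id] at this
    exact this
  have e : (ZMod.castHom dvd_rfl K).comp (Int.castRingHom (ZMod p)) = Int.castRingHom K :=
    RingHom.ext_int _ _
  rw [← e, PowerSeries.map_comp, RingHom.comp_apply, ← map_expand, key, map_pow]

lemma kleinExp_mul_prime {p : ℕ} [Fact p.Prime] {K : Type*} [CommRing K] [CharP K p] (k : ℕ)
    (hk : k ≠ 0) (hkp : k * p ≠ 0) : kleinExp (k * p) hkp (1 : K) 1 = kleinExp k hk (1 : K) 1 ^ p := by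
  rw [kleinExp, kleinExp, map_one, one_mul, one_mul, rescale_one, RingHom.id_apply,
    expand_mul (hp := hk) (hq := (Fact.out : p.Prime).ne_zero), expand_map_intCast_eq_pow, map_pow]

lemma prod_heckeReps_prime {p : ℕ} (hp : p.Prime) {M : Type*} [CommMonoid M]
    (f : ℕ × ℕ × ℕ → M) :
    ∏ t ∈ heckeReps p, f t = f (p, 0, 1) * ∏ b ∈ Finset.range p, f (1, b, p) := by
  classical
  have h : heckeReps p = insert (p, 0, 1) ((Finset.range p).image fun b => (1, b, p)) := by
    ext ⟨a, b, d⟩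
    rw [mem_heckeReps hp.pos]
    simp only [Finset.mem_insert, Finset.mem_image, Finset.mem_range, Prod.mk.injEq]
    constructor
    · rintro ⟨h1, h2, h3⟩
      rcases (Nat.dvd_prime hp).1 ⟨d, h1.symm⟩ with rfl | rfl
      · right; exact ⟨b, by omega, rfl, rfl, by omega⟩
      · left
        have : d = 1 := Nat.eq_of_mul_eq_mul_left hp.pos (by omega)
        omega
    · rintro (⟨rfl, rfl, rfl⟩ | ⟨b, hb, rfl, rfl, rfl⟩)
      · simp
      · simp [hb]
  rw [h, Finset.prod_insert, Finset.prod_image]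
  · intro b _ b' _ h
    simpa using h
  · simp only [Finset.mem_image, Prod.mk.injEq, not_exists, not_and]
    intro b _ h1
    exact absurd h1 hp.one_lt.ne

/-- The expansion of `∏ (α - j(tτ)) - (α ^ p - j(τ)) (α - j(τ) ^ p)`, with the roots of unity
`w` and their inverses `w'` as parameters. -/
noncomputable def kroneckerSeries {R : Type*} [CommRing R] (p : ℕ) (hp : p ≠ 0) (α w w' : R) :
    PowerSeries R :=
  (X ^ p ^ 2 * C α - kleinExp (p ^ 2) (pow_ne_zero 2 hp) 1 1) *
    ∏ b ∈ Finset.range p, (X ^ 1 ^ 2 * C α - kleinExp (1 ^ 2) (by norm_num) (w ^ b) (w' ^ b)) -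
  (X ^ p * C (α ^ p) - kleinExp p hp 1 1) * (X ^ (p * p) * C α - kleinExp p hp 1 1 ^ p)

lemma kroneckerSeries_map {R S : Type*} [CommRing R] [CommRing S] (φ : R →+* S) (p : ℕ)
    (hp : p ≠ 0) (α w w' : R) :
    (kroneckerSeries p hp α w w').map φ = kroneckerSeries p hp (φ α) (φ w) (φ w') := by
  simp only [kroneckerSeries, map_sub, map_mul, map_prod, map_pow, PowerSeries.map_X, kleinExp_map,
    map_one, PowerSeries.map_C]

lemma kroneckerSeries_eq_zero {p : ℕ} [Fact p.Prime] {K : Type*} [CommRing K] [CharP K p]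
    (hp : p ≠ 0) (α : K) : kroneckerSeries p hp α 1 1 = 0 := by
  have : CharP (PowerSeries K) p := charP_of_injective_ringHom (C_injective (R := K)) p
  have k1 : kleinExp (p ^ 2) (pow_ne_zero 2 hp) (1 : K) 1 = kleinExp p hp (1 : K) 1 ^ p := by
    have := kleinExp_mul_prime (K := K) p hp (Nat.mul_ne_zero hp hp)
    convert! this using 2
    exact sq p
  have k2 : kleinExp p hp (1 : K) 1 = kleinExp (1 ^ 2) (by norm_num) (1 : K) 1 ^ p := by
    have := kleinExp_mul_prime (K := K) (1 ^ 2) (by norm_num) (by simpa using hp)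
    convert! this using 2
    simp
  have k3 : (X ^ 1 ^ 2 * C α - kleinExp (1 ^ 2) (by norm_num) (1 : K) 1) ^ p =
      X ^ p * C (α ^ p) - kleinExp p hp 1 1 := by
    rw [sub_pow_char, k2, mul_pow, map_pow, ← pow_mul]
    simp
  simp only [kroneckerSeries, one_pow, Finset.prod_const, Finset.card_range]
  simp only [one_pow] at k3
  rw [k3, k1, ← sq p]
  ring

lemma hasExp_kronecker {p : ℕ} (hp : p.Prime) (α : ℂ) :
    HasExp p (fun z => ∏ t ∈ heckeReps p, (α - kleinAt t z) - (α ^ p - klein z) * (α - klein z ^ p))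
      (p ^ 2 + p) (kroneckerSeries p hp.ne_zero α (Complex.exp (2 * Real.pi * Complex.I / p))
        (Complex.exp (2 * Real.pi * Complex.I / p))⁻¹) := by
  have c1 : HasExp p (fun _ => α) 0 (C α) := HasExp.const p _
  have c2 : HasExp p (fun _ => α ^ p) 0 (C (α ^ p)) := HasExp.const p _
  have e1 := hasExp_kleinAt (b := 0) (mul_one p) hp.pos one_pos
  rw [mul_zero, pow_zero, inv_one] at e1
  have f1 := (c1.shift (p ^ 2)).sub (by rw [zero_add]; exact e1)
  have f2 := HasExp.prod (Finset.range p) (fun b _ => (c1.shift (1 ^ 2)).sub (by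
    rw [zero_add]; exact hasExp_kleinAt (b := b) (one_mul p) one_pos hp.pos))
  have f3 := (c2.shift p).sub (by rw [zero_add]; exact hasExp_klein hp.pos)
  have f4 := (c1.shift (p * p)).sub (by rw [zero_add]; exact (hasExp_klein hp.pos).pow p)
  have f5 := f1.mul f2
  have f6 := f3.mul f4
  have n1 : 0 + p ^ 2 + ∑ i ∈ Finset.range p, (0 + 1 ^ 2) = p ^ 2 + p := by simp
  have n2 : 0 + p + (0 + p * p) = p ^ 2 + p := by ring
  rw [n1] at f5
  rw [n2] at f6
  have f7 := f5.sub f6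
  simp only [prod_heckeReps_prime hp, kroneckerSeries, inv_pow]
  simp only [one_mul] at f7
  exact f7

lemma charP_quotient_of_mem {R : Type*} [CommRing R] {P : Ideal R} (hP : P.IsPrime) {p : ℕ}
    (hp : p.Prime) (hpP : (p : R) ∈ P) : CharP (R ⧸ P) p := by
  have : Nontrivial (R ⧸ P) := Ideal.Quotient.nontrivial_iff.2 hP.ne_top
  have h : ringChar (R ⧸ P) ∣ p := by
    rw [← ringChar.spec, ← map_natCast (Ideal.Quotient.mk P)]
    exact Ideal.Quotient.eq_zero_iff_mem.2 hpP
  have h1 : ringChar (R ⧸ P) ≠ 1 := CharP.ringChar_ne_one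
  exact ringChar.of_eq (((Nat.dvd_prime hp).1 h).resolve_left h1)

/-- Kronecker's congruence at a prime above `p`. -/
theorem kronecker_congruence {p : ℕ} (hp : p.Prime) (P : Ideal (integralClosure ℤ ℂ)) (hP : P.IsPrime)
    (hpP : (p : integralClosure ℤ ℂ) ∈ P) {τ : ℍ} {t : ℕ × ℕ × ℕ} (ht : t ∈ heckeReps p)
    {α β : integralClosure ℤ ℂ} (hα : kleinAt t τ = α) (hβ : klein τ = β) :
    (α ^ p - β) * (α - β ^ p) ∈ P := by
  have : Fact p.Prime := ⟨hp⟩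
  set G : ℍ → ℂ := fun z => ∏ t ∈ heckeReps p, ((α : ℂ) - kleinAt t z) -
    ((α : ℂ) ^ p - klein z) * ((α : ℂ) - klein z ^ p) with hG
  have hinv : ∀ (γ : Matrix.SpecialLinearGroup (Fin 2) ℤ) z, G (γ • z) = G z := fun γ z => by
    simp only [hG, klein_smul]
    rw [prod_kleinAt_smul hp.pos γ (fun x => (α : ℂ) - x)]
  have hconst : ∀ c : ℂ, MDifferentiable 𝓘(ℂ) 𝓘(ℂ) (fun _ : ℍ => c) := fun c => mdifferentiable_const
  have hhol : MDifferentiable 𝓘(ℂ) 𝓘(ℂ) G := by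
    refine mdifferentiable_sub' (mdifferentiable_prod _ _ fun t ht =>
      mdifferentiable_sub' (hconst _) (mdifferentiable_kleinAt (heckeReps_pos hp.pos ht)))
      (MDifferentiable.mul (mdifferentiable_sub' (hconst _) mdifferentiable_klein)
        (mdifferentiable_sub' (hconst _) (mdifferentiable_klein.pow p)))
  set ω : ℂ := Complex.exp (2 * Real.pi * Complex.I / p) with hω
  have hprim : IsPrimitiveRoot ω p := Complex.isPrimitiveRoot_exp p hp.ne_zero
  set w : integralClosure ℤ ℂ := ⟨ω, hprim.isIntegral hp.pos⟩ with hw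
  set w' : integralClosure ℤ ℂ := ⟨ω⁻¹, hprim.inv.isIntegral hp.pos⟩ with hw'
  set S := kroneckerSeries p hp.ne_zero α w w' with hS
  have hSexp : HasExp p G (p ^ 2 + p) (S.map (algebraMap (integralClosure ℤ ℂ) ℂ)) := by
    rw [hS, kroneckerSeries_map]
    exact hasExp_kronecker hp α
  have hSP : S.map (Ideal.Quotient.mk P) = 0 := by
    have : IsDomain (integralClosure ℤ ℂ ⧸ P) := Ideal.Quotient.isDomain P
    have : CharP (integralClosure ℤ ℂ ⧸ P) p := charP_quotient_of_mem hP hp hpP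
    have hw1 : Ideal.Quotient.mk P w = 1 := by
      have h1 : w ^ p = 1 := Subtype.ext hprim.pow_eq_one
      have h2 : (Ideal.Quotient.mk P w - 1) ^ p = 0 := by
        rw [sub_pow_char, ← map_pow, h1, map_one, one_pow, sub_self]
      exact sub_eq_zero.1 (pow_eq_zero_iff hp.ne_zero |>.1 h2)
    have hw1' : Ideal.Quotient.mk P w' = 1 := by
      have h1 : w * w' = 1 := Subtype.ext (mul_inv_cancel₀ (hprim.ne_zero hp.ne_zero))
      have h2 := congrArg (Ideal.Quotient.mk P) h1
      rwa [map_mul, hw1, one_mul, map_one] at h2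
    rw [hS, kroneckerSeries_map, hw1, hw1', kroneckerSeries_eq_zero]
  obtain ⟨Q, hQ, hQev, -, -⟩ := exists_polynomial_klein
    ((Submodule.toAddSubgroup P).map (algebraMap (integralClosure ℤ ℂ) ℂ).toAddMonoidHom)
    hp.pos _ G _ hinv hhol hSexp (fun n => by
      have h1 := congrArg (coeff n) hSP
      rw [coeff_map, map_zero, Ideal.Quotient.eq_zero_iff_mem] at h1
      exact ⟨_, h1, (coeff_map (algebraMap (integralClosure ℤ ℂ) ℂ) n S).symm⟩)
  have hmem : G τ ∈ (Submodule.toAddSubgroup P).map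
      (algebraMap (integralClosure ℤ ℂ) ℂ).toAddMonoidHom := by
    rw [hQev, hβ, Polynomial.eval_eq_sum_range]
    refine sum_mem fun n _ => ?_
    obtain ⟨y, hy, hy2⟩ := hQ n
    refine ⟨y * β ^ n, P.mul_mem_right _ hy, ?_⟩
    rw [← hy2]
    exact map_mul (algebraMap (integralClosure ℤ ℂ) ℂ) y (β ^ n)
  have hGτ : G τ = -(((α ^ p - β) * (α - β ^ p) : integralClosure ℤ ℂ) : ℂ) := by
    simp only [hG, hβ]
    rw [Finset.prod_eq_zero ht (by rw [hα, sub_self])]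
    push_cast
    ring
  obtain ⟨y, hy, hy2⟩ := hmem
  have : (α ^ p - β) * (α - β ^ p) = -y := Subtype.ext (by
    have : (y : ℂ) = G τ := hy2
    push_cast at hGτ ⊢
    rw [this, hGτ, neg_neg])
  rw [this]
  exact neg_mem hy

end

section

open UpperHalfPlane PowerSeries
open scoped Manifold

/-- The expansion of `j(τ) - j((a τ + b) / d)` with `m = a * d`, with the root of unity `ω` as a
parameter. -/
noncomputable def heckeTerm {F : Type*} [Field F] (m : ℕ) (hm : m ≠ 0) (ω : F) (t : ℕ × ℕ × ℕ) :
    PowerSeries F :=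
  if h : t.1 ^ 2 ≠ 0 then X ^ t.1 ^ 2 * kleinExp m hm 1 1 -
    X ^ m * kleinExp (t.1 ^ 2) h (ω ^ (t.1 * t.2.1)) (ω ^ (t.1 * t.2.1))⁻¹ else 0

lemma heckeTerm_map {F L : Type*} [Field F] [Field L] (φ : F →+* L) (m : ℕ) (hm : m ≠ 0) (ω : F)
    (t : ℕ × ℕ × ℕ) : (heckeTerm m hm ω t).map φ = heckeTerm m hm (φ ω) t := by
  unfold heckeTerm
  split_ifs with h
  · simp only [map_sub, map_mul, map_pow, PowerSeries.map_X, kleinExp_map, map_one, map_inv₀]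
  · exact map_zero _

lemma hasExp_heckeProd {m : ℕ} (hm : 0 < m) :
    HasExp m (heckeProd m) (∑ t ∈ heckeReps m, (m + t.1 ^ 2))
      (∏ t ∈ heckeReps m, heckeTerm m hm.ne' (Complex.exp (2 * Real.pi * Complex.I / m)) t) := by
  refine HasExp.prod _ fun t ht => ?_
  obtain ⟨a, b, d⟩ := t
  obtain ⟨ha, hd⟩ := heckeReps_pos hm ht
  have had := ((mem_heckeReps hm).1 ht).1
  simp only at ha hd had
  have ha2 : a ^ 2 ≠ 0 := by positivity
  have e1 := (hasExp_klein hm).shift (a ^ 2)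
  have e2 := (hasExp_kleinAt (b := b) had ha hd).shift m
  rw [add_comm] at e2
  rw [heckeTerm, dif_pos ha2]
  exact e1.sub e2

lemma prod_heckeTerm_pow {F : Type*} [Field F] {m k : ℕ} (hm : 0 < m) (hk : k.Coprime m) {ω : F}
    (hω : ω ^ m = 1) : ∏ t ∈ heckeReps m, heckeTerm m hm.ne' (ω ^ k) t =
      ∏ t ∈ heckeReps m, heckeTerm m hm.ne' ω t := by
  have hmaps : ∀ t ∈ heckeReps m, (t.1, (k * t.2.1) % t.2.2, t.2.2) ∈ heckeReps m := fun t ht => by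
    have hpos := heckeReps_pos hm ht
    obtain ⟨h1, h2, h3⟩ := (mem_heckeReps hm).1 ht
    refine (mem_heckeReps hm).2 ⟨h1, Nat.mod_lt _ hpos.2, ?_⟩
    have hkd : k.Coprime t.2.2 := hk.coprime_dvd_right ⟨t.1, by rw [mul_comm]; exact h1.symm⟩
    simp only
    have e : ((k * t.2.1) % t.2.2).gcd t.2.2 = t.2.1.gcd t.2.2 := by
      rw [← Nat.gcd_rec, Nat.gcd_comm, Nat.Coprime.gcd_mul_left_cancel _ hkd]
    rw [Nat.gcd_assoc, e, ← Nat.gcd_assoc]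
    exact h3
  have hinj : Set.InjOn (fun t : ℕ × ℕ × ℕ => (t.1, (k * t.2.1) % t.2.2, t.2.2)) (heckeReps m) := by
    rintro ⟨a, b, d⟩ ht ⟨a', b', d'⟩ ht' h
    obtain ⟨h1, h2, h3⟩ := (mem_heckeReps hm).1 ht
    obtain ⟨g1, g2, g3⟩ := (mem_heckeReps hm).1 ht'
    simp only [Prod.mk.injEq] at h h1 h2 g2
    obtain ⟨rfl, h4, rfl⟩ := h
    have hkd : d.Coprime k := (hk.coprime_dvd_right ⟨a, by rw [mul_comm]; exact h1.symm⟩).symm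
    have h5 : b ≡ b' [MOD d] := Nat.ModEq.cancel_left_of_coprime hkd h4
    have h6 : b = b' := Nat.ModEq.eq_of_lt_of_lt h5 h2 g2
    rw [h6]
  refine Finset.prod_nbij (fun t => (t.1, (k * t.2.1) % t.2.2, t.2.2)) hmaps hinj
    (Finset.surjOn_of_injOn_of_card_le _ hmaps hinj le_rfl) fun t ht => ?_
  have h1 := ((mem_heckeReps hm).1 ht).1
  have e : (ω ^ k) ^ (t.1 * t.2.1) = ω ^ (t.1 * (k * t.2.1 % t.2.2)) := by
    rw [← pow_mul]
    have h2 : k * (t.1 * t.2.1) = t.1 * (k * t.2.1 % t.2.2) + m * (k * t.2.1 / t.2.2) := by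
      rw [← h1, mul_assoc, ← mul_add, Nat.mod_add_div]
      ring
    rw [h2, pow_add, pow_mul ω m, hω, one_pow, mul_one]
  simp only [heckeTerm, e]

lemma coeff_prod_heckeTerm_mem_range {m : ℕ} (hm : 0 < m) (n : ℕ) :
    coeff n (∏ t ∈ heckeReps m, heckeTerm m hm.ne' (Complex.exp (2 * Real.pi * Complex.I / m)) t) ∈
      (algebraMap ℚ ℂ).range := by
  have : NeZero m := ⟨hm.ne'⟩
  set F := algebraicClosure ℚ ℂ
  have hprim := Complex.isPrimitiveRoot_exp m hm.ne'
  have : IsAlgClosure ℚ F := algebraicClosure.isAlgClosure ℚ ℂ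
  have : Algebra.IsAlgebraic ℚ F := inferInstance
  have : IsGalois ℚ F := IsAlgClosure.isGalois ℚ F
  set ω : F := ⟨_, mem_algebraicClosure_iff.2 ((hprim.isIntegral hm).tower_top (A := ℚ)).isAlgebraic⟩ with hω
  have hω' : algebraMap F ℂ ω = Complex.exp (2 * Real.pi * Complex.I / m) := rfl
  have hωprim : IsPrimitiveRoot ω m := by
    rw [← hω'] at hprim
    exact hprim.of_map_of_injective (algebraMap F ℂ).injective
  set S := ∏ t ∈ heckeReps m, heckeTerm m hm.ne' ω t with hS
  have hmap : ∏ t ∈ heckeReps m, heckeTerm m hm.ne' (Complex.exp (2 * Real.pi * Complex.I / m)) t =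
      S.map (algebraMap F ℂ) := by
    rw [hS, map_prod]
    simp only [heckeTerm_map, hω']
  rw [hmap, coeff_map]
  have hfix : ∀ σ : F ≃ₐ[ℚ] F, σ (coeff n S) = coeff n S := fun σ => by
    have h1 : S.map (σ : F →+* F) = S := by
      have h2 : IsPrimitiveRoot (σ ω) m := hωprim.map_of_injective (f := σ) σ.injective
      obtain ⟨k, -, hk⟩ := hωprim.eq_pow_of_pow_eq_one h2.pow_eq_one
      have hcop : k.Coprime m := by
        rw [← hωprim.pow_iff_coprime hm, hk]
        exact h2
      rw [hS, map_prod]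
      simp only [heckeTerm_map]
      change ∏ t ∈ heckeReps m, heckeTerm m hm.ne' (σ ω) t = _
      rw [← hk, prod_heckeTerm_pow hm hcop hωprim.pow_eq_one]
    have h3 := congrArg (coeff n) h1
    rwa [coeff_map] at h3
  obtain ⟨r, hr⟩ := (InfiniteGalois.mem_range_algebraMap_iff_fixed (k := ℚ) (K := F) (coeff n S)).2 hfix
  refine ⟨r, ?_⟩
  rw [← hr]
  exact IsScalarTower.algebraMap_apply ℚ F ℂ r

/-- The product over primitive matrices of determinant `m` is a rational polynomial in `j`. -/
theorem exists_rat_polynomial_heckeProd {m : ℕ} (hm : 0 < m) :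
    ∃ P : Polynomial ℚ, ∀ z : ℍ, heckeProd m z = Polynomial.aeval (klein z) P := by
  obtain ⟨P, hP, hPev, -, -⟩ := exists_polynomial_klein (algebraMap ℚ ℂ).range.toAddSubgroup hm _ _ _
    (fun γ z => heckeProd_smul hm γ z) (mdifferentiable_heckeProd hm) (hasExp_heckeProd hm)
    (coeff_prod_heckeTerm_mem_range hm)
  obtain ⟨Q, rfl⟩ := (Polynomial.lifts_iff_coeff_lifts P).2 fun n => hP n
  refine ⟨Q, fun z => ?_⟩
  rw [hPev, Polynomial.aeval_def, ← Polynomial.eval_map]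
  rfl

/-- A conjugate of a zero `j(τ)` of the Hecke polynomial is again a zero. -/
theorem exists_heckeProd_eq_zero_of_aeval_minpoly {m : ℕ} (hm : 0 < m) {τ : ℍ}
    (h : heckeProd m τ = 0) {y : ℂ} (hy : Polynomial.aeval y (minpoly ℚ (klein τ)) = 0) {σ : ℍ}
    (hσ : klein σ = y) : heckeProd m σ = 0 := by
  obtain ⟨P, hP⟩ := exists_rat_polynomial_heckeProd hm
  obtain ⟨Q, hQ⟩ := minpoly.dvd ℚ (klein τ) ((hP τ).symm.trans h)
  rw [hP, hσ, hQ, map_mul, hy, zero_mul]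

end

section

open UpperHalfPlane

/-- `τ` is a root of a primitive positive definite integral form of discriminant `Δ`. -/
def HasDisc (τ : ℂ) (Δ : ℤ) : Prop :=
  ∃ a b c : ℤ, 0 < a ∧ Int.gcd a (Int.gcd b c) = 1 ∧
    (a : ℂ) * τ ^ 2 + (b : ℂ) * τ + (c : ℂ) = 0 ∧ Δ = b ^ 2 - 4 * a * c

lemma isUnit_of_dvd_of_gcd_eq_one {a b c k : ℤ} (h : Int.gcd a (Int.gcd b c) = 1) (ha : k ∣ a)
    (hb : k ∣ b) (hc : k ∣ c) : IsUnit k := by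
  have h1 : k ∣ (Int.gcd a (Int.gcd b c) : ℤ) := Int.dvd_coe_gcd ha (Int.dvd_coe_gcd hb hc)
  rw [h] at h1
  exact isUnit_of_dvd_one (by simpa using h1)

lemma gcd_eq_one_of_isUnit {a b c : ℤ} (h : ∀ k, k ∣ a → k ∣ b → k ∣ c → IsUnit k) :
    Int.gcd a (Int.gcd b c) = 1 := by
  have h1 : (Int.gcd a (Int.gcd b c) : ℤ) ∣ (Int.gcd b c : ℤ) := Int.gcd_dvd_right _ _
  have := h (Int.gcd a (Int.gcd b c)) (Int.gcd_dvd_left _ _)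
    (h1.trans (Int.gcd_dvd_left _ _)) (h1.trans (Int.gcd_dvd_right _ _))
  simpa [Int.isUnit_iff_natAbs_eq] using this

lemma eq_zero_of_linear_eq_zero {z : ℂ} (hz : z.im ≠ 0) {x y : ℤ} (h : (x : ℂ) * z + y = 0) :
    x = 0 ∧ y = 0 := by
  have h1 := congrArg Complex.im h
  simp only [Complex.add_im, Complex.mul_im, Complex.intCast_re, Complex.intCast_im, zero_mul,
    add_zero, Complex.zero_im, mul_eq_zero, hz, or_false] at h1
  have hx : x = 0 := by exact_mod_cast h1
  subst hx
  simp only [Int.cast_zero, zero_mul, zero_add, Int.cast_eq_zero] at h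
  exact ⟨rfl, h⟩

lemma HasDisc.neg {τ : ℂ} (hτ : 0 < τ.im) {Δ : ℤ} (h : HasDisc τ Δ) : Δ < 0 := by
  obtain ⟨a, b, c, ha, -, h1, rfl⟩ := h
  have h2 : (2 * (a : ℂ) * τ + b) ^ 2 = ((b ^ 2 - 4 * a * c : ℤ) : ℂ) := by
    push_cast
    linear_combination 4 * (a : ℂ) * h1
  set w := 2 * (a : ℂ) * τ + b with hw
  have him : w.im ≠ 0 := by
    have : w.im = 2 * a * τ.im := by simp [hw]
    rw [this]
    have : (0 : ℝ) < a := by exact_mod_cast ha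
    positivity
  have h3 := congrArg Complex.im h2
  have h4 := congrArg Complex.re h2
  rw [sq] at h3 h4
  simp only [Complex.mul_im, Complex.mul_re, Complex.intCast_im, Complex.intCast_re] at h3 h4
  have hre : w.re = 0 := by
    have : w.re * w.im = 0 := by linarith
    exact (mul_eq_zero.1 this).resolve_right him
  have h5 : ((b ^ 2 - 4 * a * c : ℤ) : ℝ) < 0 := by
    rw [← h4, hre]
    have := mul_self_pos.2 him
    linarith
  exact_mod_cast h5

/-- An integral quadratic relation for `τ` is a multiple of the primitive one. -/
lemma exists_eq_mul_of_quadratic {τ : ℂ} (hτ : 0 < τ.im) {a b c x y z : ℤ} (ha : 0 < a)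
    (hg : Int.gcd a (Int.gcd b c) = 1) (h : (a : ℂ) * τ ^ 2 + (b : ℂ) * τ + (c : ℂ) = 0)
    (h' : (x : ℂ) * τ ^ 2 + (y : ℂ) * τ + (z : ℂ) = 0) :
    ∃ v : ℤ, x = v * a ∧ y = v * b ∧ z = v * c := by
  obtain ⟨h1, h2⟩ := eq_zero_of_linear_eq_zero hτ.ne' (x := a * y - x * b) (y := a * z - x * c)
    (by push_cast; linear_combination (a : ℂ) * h' - (x : ℂ) * h)
  have hdvd : a ∣ x := by
    have e : (Int.gcd a (Int.gcd b c) : ℤ) = 1 := by rw [hg]; rfl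
    have e1 := Int.gcd_eq_gcd_ab a (Int.gcd b c)
    have e2 := Int.gcd_eq_gcd_ab b c
    rw [e] at e1
    set g : ℤ := ((Int.gcd b c : ℕ) : ℤ)
    generalize Int.gcdA a g = p at e1
    generalize Int.gcdB a g = q at e1
    generalize Int.gcdA b c = r at e2
    generalize Int.gcdB b c = s at e2
    refine ⟨p * x + q * r * y + q * s * z, ?_⟩
    linear_combination x * e1 + x * q * e2 - q * r * h1 - q * s * h2
  obtain ⟨v, rfl⟩ := hdvd
  refine ⟨v, by ring, ?_, ?_⟩
  · exact mul_left_cancel₀ ha.ne' (by linear_combination h1)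
  · exact mul_left_cancel₀ ha.ne' (by linear_combination h2)

lemma heckeProd_eq_zero_of_fixed {m : ℕ} (hm : 0 < m) {τ : ℍ} {A B C D : ℤ}
    (hdet : A * D - B * C = m) (hprim : ∀ k : ℤ, k ∣ A → k ∣ B → k ∣ C → k ∣ D → IsUnit k)
    (hfix : (A : ℂ) * τ + B = ((C : ℂ) * τ + D) * τ) : heckeProd m τ = 0 := by
  obtain ⟨t, ht, p, q, r, s, hpq, hA, hB, hC, hD⟩ := exists_heckeRep hm A B C D hdet hprim
  have h1 := klein_div_eq_kleinAt (heckeReps_pos hm ht) hpq hA hB hC hD τ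
  have hne : (C : ℂ) * τ + D ≠ 0 := fun h => by
    obtain ⟨rfl, rfl⟩ := eq_zero_of_linear_eq_zero τ.im_pos.ne' h
    simp at hdet
    omega
  rw [hfix, mul_div_cancel_left₀ _ hne] at h1
  exact Finset.prod_eq_zero ht (by rw [h1, sub_self])

lemma exists_fixed_of_heckeProd_eq_zero {m : ℕ} (hm : 0 < m) {τ : ℍ} (h : heckeProd m τ = 0) :
    ∃ A B C D : ℤ, A * D - B * C = m ∧
      (∀ k : ℤ, k ∣ A → k ∣ B → k ∣ C → k ∣ D → IsUnit k) ∧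
      (A : ℂ) * τ + B = ((C : ℂ) * τ + D) * τ := by
  obtain ⟨t, ht, h0⟩ := Finset.prod_eq_zero_iff.1 h
  obtain ⟨a, b, d⟩ := t
  obtain ⟨ha, hd⟩ := heckeReps_pos hm ht
  obtain ⟨had, -, hg⟩ := (mem_heckeReps hm).1 ht
  simp only at ha hd had hg
  rw [sub_eq_zero, kleinAt_eq a b d ha hd] at h0
  obtain ⟨γ, hγ⟩ := exists_smul_eq_of_klein_eq _ _ h0.symm
  have h1 := coe_smul_eq_div γ (affineMap a b d ha hd τ)
  rw [hγ] at h1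
  have hdet : γ 0 0 * γ 1 1 - γ 0 1 * γ 1 0 = 1 := by
    have := γ.det_coe
    rwa [Matrix.det_fin_two] at this
  set p := γ 0 0
  set q := γ 0 1
  set r := γ 1 0
  set s := γ 1 1
  refine ⟨p * a, p * b + q * d, r * a, r * b + s * d, ?_, fun k k1 k2 k3 k4 => ?_, ?_⟩
  · rw [← had]; push_cast; linear_combination (a * d : ℤ) * hdet
  · have l1 : k ∣ a := by
      have := (k1.mul_left s).sub (k3.mul_left q)
      rwa [show s * (p * a) - q * (r * a) = (a : ℤ) by linear_combination (a : ℤ) * hdet] at this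
    have l2 : k ∣ b := by
      have := (k2.mul_left s).sub (k4.mul_left q)
      rwa [show s * (p * b + q * d) - q * (r * b + s * d) = (b : ℤ) by
        linear_combination (b : ℤ) * hdet] at this
    have l3 : k ∣ d := by
      have := (k4.mul_left p).sub (k2.mul_left r)
      rwa [show p * (r * b + s * d) - r * (p * b + q * d) = (d : ℤ) by
        linear_combination (d : ℤ) * hdet] at this
    refine isUnit_of_dvd_of_gcd_eq_one (a := a) (b := b) (c := d) ?_ l1 l2 l3
    rw [Nat.gcd_assoc] at hg
    exact_mod_cast hg
  · have hdC : (d : ℂ) ≠ 0 := by exact_mod_cast hd.ne'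
    have hz : ((affineMap a b d ha hd τ : ℍ) : ℂ) = ((a : ℂ) * τ + b) / d := rfl
    have hne : (r : ℂ) * (affineMap a b d ha hd τ : ℍ) + s ≠ 0 := fun h => by
      obtain ⟨e1, e2⟩ := eq_zero_of_linear_eq_zero (affineMap a b d ha hd τ).im_pos.ne' h
      rw [e1, e2] at hdet
      simp at hdet
    rw [eq_div_iff hne, hz] at h1
    field_simp at h1
    push_cast
    linear_combination -h1

/-- Existence of a fixing matrix in terms of the discriminant. -/
lemma heckeProd_eq_zero_of_hasDisc {m : ℕ} (hm : 0 < m) {τ : ℍ} {D u : ℤ} (h : HasDisc τ (-D))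
    (hu : u ^ 2 + D = 4 * m) : heckeProd m τ = 0 := by
  obtain ⟨a, b, c, ha, hg, h1, hD⟩ := h
  have hpar : (2 : ℤ) ∣ u - b := by
    have h2 : (2 : ℤ) ∣ (u - b) ^ 2 := ⟨2 * m + b ^ 2 - u * b - 2 * a * c, by linear_combination hu + hD⟩
    exact Int.prime_two.dvd_of_dvd_pow h2
  obtain ⟨k, hk⟩ := hpar
  refine heckeProd_eq_zero_of_fixed hm (A := k) (B := -c) (C := a) (D := k + b) ?_ ?_ ?_
  · have hu' : u = 2 * k + b := by linarith
    rw [hu'] at hu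
    linarith
  · intro l l1 l2 l3 l4
    refine isUnit_of_dvd_of_gcd_eq_one hg l3 ?_ ((dvd_neg).1 l2)
    simpa using l4.sub l1
  · push_cast
    linear_combination -h1

lemma exists_repr_of_heckeProd_eq_zero {m : ℕ} (hm : 1 < m) {τ : ℍ} {D : ℤ} (h : HasDisc τ (-D))
    (h0 : heckeProd m τ = 0) : ∃ u v : ℤ, v ≠ 0 ∧ 4 * (m : ℤ) = u ^ 2 + v ^ 2 * D ∧
      ∀ u' v', u = 2 * u' → v = 2 * v' → ¬ (2 : ℤ) ∣ u' + v' * D := by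
  obtain ⟨a, b, c, ha, hg, h1, hD⟩ := h
  obtain ⟨A, B, C, E, hdet, hprim, hfix⟩ := exists_fixed_of_heckeProd_eq_zero (by omega) h0
  obtain ⟨v, e1, e2, e3⟩ := exists_eq_mul_of_quadratic τ.im_pos ha hg h1 (x := C) (y := E - A)
    (z := -B) (by push_cast; linear_combination -hfix)
  have hB : B = -(v * c) := by linarith
  have hE : E = A + v * b := by linarith
  subst e1 hB hE
  refine ⟨2 * A + v * b, v, ?_, ?_, ?_⟩
  · rintro rfl
    have := hprim A dvd_rfl (by simp) (by simp) (by simp)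
    simp at hdet
    rcases Int.isUnit_iff.1 this with rfl | rfl <;> norm_num at hdet <;> omega
  · linear_combination -4 * hdet + v ^ 2 * hD
  · rintro u' v' hu rfl hdvd
    have hA : A = u' - v' * b := by linarith
    have hpar : (2 : ℤ) ∣ D - b := by
      have : Even (b ^ 2 - b) := by
        rw [show b ^ 2 - b = b * (b - 1) by ring]; exact Int.even_mul_pred_self b
      obtain ⟨k, hk⟩ := this
      exact ⟨2 * a * c - k - b, by linear_combination -hD - hk⟩
    have h2A : (2 : ℤ) ∣ A := by
      obtain ⟨k, hk⟩ := hdvd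
      obtain ⟨l, hl⟩ := hpar
      exact ⟨k - v' * l - v' * b, by rw [hA]; linear_combination hk - v' * hl⟩
    have := hprim 2 h2A ⟨-(v' * c), by ring⟩ ⟨v' * a, by ring⟩
      (dvd_add h2A ⟨v' * b, by ring⟩)
    exact absurd this (by decide)

/-- Singular moduli are algebraic integers. -/
theorem HasDisc.isIntegral_klein {τ : ℍ} {Δ : ℤ} (h : HasDisc τ Δ) : IsIntegral ℤ (klein τ) := by
  have hneg := h.neg τ.im_pos
  have hmod : ∃ n : ℕ, 0 < n ∧ (-Δ = 4 * n ∨ -Δ = 4 * n - 1) := by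
    obtain ⟨a, b, c, -, -, -, hD⟩ := h
    rcases Int.even_or_odd' b with ⟨k, rfl | rfl⟩
    · refine ⟨(a * c - k ^ 2).toNat, ?_, Or.inl ?_⟩ <;> ring_nf at * <;> omega
    · refine ⟨(a * c - k ^ 2 - k).toNat, ?_, Or.inr ?_⟩ <;> ring_nf at * <;> omega
  obtain ⟨n, hn, hD⟩ := hmod
  have h' : HasDisc τ (-(-Δ)) := by rwa [neg_neg]
  have key : ∀ (m : ℕ) (u : ℤ), 0 < m → u ^ 2 + -Δ = 4 * m → (∀ a : ℕ, a ^ 2 ≠ m) →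
      IsIntegral ℤ (klein τ) := fun m u hm hu hsq =>
    isIntegral_klein_of_heckeProd_eq_zero hm hsq (heckeProd_eq_zero_of_hasDisc hm h' hu)
  by_cases hsq : ∀ a : ℕ, a ^ 2 ≠ n
  · rcases hD with hD | hD
    · exact key n 0 hn (by rw [hD]; ring) hsq
    · exact key n 1 hn (by rw [hD]; ring) hsq
  · push Not at hsq
    obtain ⟨x, hx⟩ := hsq
    have hx0 : 0 < x := by
      rcases Nat.eq_zero_or_pos x with rfl | h
      · simp at hx; omega
      · exact h
    rcases hD with hD | hD
    · refine key (n + 1) 2 (by omega) (by rw [hD]; push_cast; ring) fun y hy => ?_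
      rcases Nat.lt_or_ge x y with h | h <;> nlinarith
    · refine key (n + 2) 3 (by omega) (by rw [hD]; push_cast; ring) fun y hy => ?_
      rcases Nat.lt_or_ge x y with h | h
      · rcases Nat.lt_or_ge (x + 1) y with h2 | h2
        · nlinarith
        · have : y = x + 1 := by omega
          subst this
          ring_nf at hx hy
          omega
      · nlinarith

end

section

open UpperHalfPlane

lemma exists_hasDisc_of_quadratic {σ : ℂ} (hσ : 0 < σ.im) {x y z : ℤ}
    (h : (x : ℂ) * σ ^ 2 + (y : ℂ) * σ + (z : ℂ) = 0) (hne : ¬ (x = 0 ∧ y = 0 ∧ z = 0)) :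
    ∃ Δ, HasDisc σ Δ := by
  have hx : x ≠ 0 := fun hx => by
    obtain ⟨h1, h2⟩ := eq_zero_of_linear_eq_zero hσ.ne' (x := y) (y := z) (by
      rw [hx] at h; push_cast at h; linear_combination h)
    exact hne ⟨hx, h1, h2⟩
  wlog hpos : 0 < x generalizing x y z
  · refine this (x := -x) (y := -y) (z := -z) (by push_cast; linear_combination -h) ?_ ?_ ?_
    · simpa using hne
    · simpa using hx
    · omega
  set g : ℤ := ((Int.gcd x ((Int.gcd y z : ℕ) : ℤ) : ℕ) : ℤ) with hg
  have hgpos : 0 < g := by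
    have : 0 < Int.gcd x ((Int.gcd y z : ℕ) : ℤ) := Int.gcd_pos_of_ne_zero_left _ hx
    exact Int.natCast_pos.2 this
  have h2 : g ∣ ((Int.gcd y z : ℕ) : ℤ) := Int.gcd_dvd_right _ _
  obtain ⟨a, ha⟩ : g ∣ x := Int.gcd_dvd_left _ _
  obtain ⟨b, hb⟩ : g ∣ y := h2.trans (Int.gcd_dvd_left _ _)
  obtain ⟨c, hc⟩ : g ∣ z := h2.trans (Int.gcd_dvd_right _ _)
  refine ⟨_, a, b, c, ?_, gcd_eq_one_of_isUnit fun k k1 k2 k3 => ?_, ?_, rfl⟩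
  · rw [ha] at hpos
    exact pos_of_mul_pos_right hpos hgpos.le
  · have h3 : g * k ∣ g := by
      nth_rw 2 [hg]
      refine Int.dvd_coe_gcd ?_ (Int.dvd_coe_gcd ?_ ?_)
      · rw [ha]; exact mul_dvd_mul_left g k1
      · rw [hb]; exact mul_dvd_mul_left g k2
      · rw [hc]; exact mul_dvd_mul_left g k3
    exact isUnit_of_dvd_one ((mul_dvd_mul_iff_left hgpos.ne').1 (by rwa [mul_one]))
  · have hg0 : (g : ℂ) ≠ 0 := by exact_mod_cast hgpos.ne'
    refine mul_left_cancel₀ hg0 ?_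
    rw [ha, hb, hc] at h
    push_cast at h
    linear_combination h

/-- The relation between discriminants `-D` and `-D'` imposed by fixing matrices of shared determinant. -/
def NormRel (D D' : ℤ) : Prop :=
  ∀ (m : ℕ) (u : ℤ), 1 < m → u ^ 2 + D = 4 * m → ∃ w v : ℤ, v ≠ 0 ∧
    4 * (m : ℤ) = w ^ 2 + v ^ 2 * D' ∧ ∀ w' v', w = 2 * w' → v = 2 * v' → ¬ (2 : ℤ) ∣ w' + v' * D'

lemma not_normRel_of_lt {D D' : ℤ} (hD : 0 < D) (hlt : D < D') (h4 : D % 4 = 0 ∨ D % 4 = 3)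
    (h4' : D' % 4 = 0 ∨ D' % 4 = 3) (h1 : NormRel D D') (h2 : NormRel D' D) : False := by
  have hv : ∀ v : ℤ, v ≠ 0 → 1 ≤ v ^ 2 := fun v hv => by
    have := sq_pos_of_ne_zero hv; omega
  have hsq : ∀ (w n : ℤ), 0 ≤ n → n ^ 2 < w ^ 2 → w ^ 2 < (n + 1) ^ 2 → False := fun w n hn l1 l2 => by
    have l3 := sq_lt_sq.1 l1
    have l4 := sq_lt_sq.1 l2
    rw [abs_of_nonneg hn] at l3
    rw [abs_of_nonneg (by omega : 0 ≤ n + 1)] at l4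
    omega
  have hv4 : ∀ v : ℤ, v ≠ 0 → v ^ 2 = 1 ∨ v ^ 2 = 4 ∨ 9 ≤ v ^ 2 := fun v hv => by
    have h0 : 0 < |v| := abs_pos.2 hv
    rw [← sq_abs]
    rcases (by omega : |v| = 1 ∨ |v| = 2 ∨ 3 ≤ |v|) with h | h | h
    · simp [h]
    · simp [h]
    · right; right; nlinarith
  rcases h4 with h4 | h4
  · obtain ⟨n, rfl⟩ : ∃ n, D = 4 * n := ⟨D / 4, by omega⟩
    rcases (by omega : n = 1 ∨ 1 < n) with rfl | hn
    · obtain ⟨w, v, v0, e, -⟩ := h1 2 2 (by norm_num) (by norm_num)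
      obtain ⟨w', v', v0', e', -⟩ := h1 5 4 (by norm_num) (by norm_num)
      have hw := sq_nonneg w
      push_cast at e e'
      have hD' : D' ≤ 8 := by nlinarith [hv v v0]
      have hw' := sq_nonneg w'
      rcases (by omega : D' = 7 ∨ D' = 8) with rfl | rfl
      · rcases hv4 v' v0' with h | h | h
        · exact hsq w' 3 (by norm_num) (by omega) (by omega)
        · omega
        · omega
      · rcases hv4 v' v0' with h | h | h
        · exact hsq w' 3 (by norm_num) (by omega) (by omega)
        · omega
        · omega
    · obtain ⟨w, v, v0, e, -⟩ := h1 n.toNat 0 (by omega) (by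
        rw [Int.toNat_of_nonneg (by omega)]; ring)
      rw [Int.toNat_of_nonneg (by omega)] at e
      nlinarith [hv v v0, sq_nonneg w]
  · obtain ⟨n, rfl⟩ : ∃ n, D = 4 * n + 3 := ⟨D / 4, by omega⟩
    rcases (by omega : n = 0 ∨ 0 < n) with rfl | hn
    · obtain ⟨w, v, v0, e, -⟩ := h1 3 3 (by norm_num) (by norm_num)
      obtain ⟨w', v', v0', e', -⟩ := h1 7 5 (by norm_num) (by norm_num)
      have hw := sq_nonneg w
      have hw' := sq_nonneg w'
      push_cast at e e'
      have hD' : D' ≤ 12 := by nlinarith [hv v v0]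
      rcases (by omega : D' = 4 ∨ D' = 7 ∨ D' = 8 ∨ D' = 11 ∨ D' = 12) with
        rfl | rfl | rfl | rfl | rfl
      · rcases hv4 v v0 with h | h | h
        · exact hsq w 2 (by norm_num) (by omega) (by omega)
        · omega
        · omega
      · rcases hv4 v v0 with h | h | h
        · exact hsq w 2 (by norm_num) (by omega) (by omega)
        · omega
        · omega
      · rcases hv4 v' v0' with h | h | h
        · exact hsq w' 4 (by norm_num) (by omega) (by omega)
        · omega
        · omega
      · rcases hv4 v' v0' with h | h | h
        · exact hsq w' 4 (by norm_num) (by omega) (by omega)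
        · omega
        · omega
      · obtain ⟨x, y, y0, f, hf⟩ := h2 4 2 (by norm_num) (by norm_num)
        push_cast at f
        have hx := sq_nonneg x
        rcases hv4 y y0 with h | h | h
        · exact hsq x 3 (by norm_num) (by omega) (by omega)
        · have hy2 : y = 2 ∨ y = -2 := sq_eq_sq_iff_eq_or_eq_neg.1 (by rw [h]; norm_num)
          have hx2 : x = 2 ∨ x = -2 := sq_eq_sq_iff_eq_or_eq_neg.1 (by rw [h] at f; linarith)
          rcases hy2 with rfl | rfl <;> rcases hx2 with rfl | rfl
          · exact hf 1 1 (by norm_num) (by norm_num) (by norm_num)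
          · exact hf (-1) 1 (by norm_num) (by norm_num) (by norm_num)
          · exact hf 1 (-1) (by norm_num) (by norm_num) (by norm_num)
          · exact hf (-1) (-1) (by norm_num) (by norm_num) (by norm_num)
        · omega
    · obtain ⟨w, v, v0, e, -⟩ := h1 (n + 1).toNat 1 (by omega) (by
        rw [Int.toNat_of_nonneg (by omega)]; ring)
      obtain ⟨w', v', v0', e', -⟩ := h1 (n + 3).toNat 3 (by omega) (by
        rw [Int.toNat_of_nonneg (by omega)]; ring)
      rw [Int.toNat_of_nonneg (by omega)] at e e'
      have hD' : D' = 4 * n + 4 := by nlinarith [hv v v0, sq_nonneg w]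
      subst hD'
      rcases hv4 v' v0' with h | h | h
      · rw [h] at e'
        exact hsq w' 2 (by norm_num) (by linarith) (by linarith)
      · rw [h] at e'; nlinarith [sq_nonneg w']
      · nlinarith [sq_nonneg w']

lemma HasDisc.mod_four {τ : ℂ} {D : ℤ} (h : HasDisc τ (-D)) : D % 4 = 0 ∨ D % 4 = 3 := by
  obtain ⟨a, b, c, -, -, -, hD⟩ := h
  rcases Int.even_or_odd' b with ⟨k, rfl | rfl⟩
  · left; ring_nf at hD; omega
  · right; ring_nf at hD; omega

lemma normRel_of_conjugate {τ σ : ℍ} {D D' : ℤ} (h : HasDisc τ (-D)) (h' : HasDisc σ (-D'))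
    (hc : Polynomial.aeval (klein σ) (minpoly ℚ (klein τ)) = 0) : NormRel D D' :=
  fun _ _ hm hu => exists_repr_of_heckeProd_eq_zero hm h'
    (exists_heckeProd_eq_zero_of_aeval_minpoly (by omega)
      (heckeProd_eq_zero_of_hasDisc (by omega) h hu) hc rfl)

lemma minpoly_eq_of_aeval_eq_zero {x y : ℂ} (hx : IsIntegral ℚ x)
    (hc : Polynomial.aeval y (minpoly ℚ x) = 0) : minpoly ℚ y = minpoly ℚ x :=
  (minpoly.eq_of_irreducible_of_monic (minpoly.irreducible hx) hc (minpoly.monic hx)).symm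

/-- Conjugates of a singular modulus are singular moduli of the same discriminant. -/
theorem exists_hasDisc_of_conjugate {τ : ℍ} {Δ : ℤ} (h : HasDisc τ Δ) {y : ℂ}
    (hy : Polynomial.aeval y (minpoly ℚ (klein τ)) = 0) : ∃ σ : ℍ, klein σ = y ∧ HasDisc σ Δ := by
  obtain ⟨σ, rfl⟩ := klein_surjective y
  refine ⟨σ, rfl, ?_⟩
  have hneg := h.neg τ.im_pos
  have h₀ := h
  obtain ⟨D, rfl⟩ : ∃ D, Δ = -D := ⟨-Δ, by ring⟩
  obtain ⟨m, u, hm, hu⟩ : ∃ (m : ℕ) (u : ℤ), 1 < m ∧ u ^ 2 + D = 4 * m := by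
    rcases h.mod_four with h4 | h4
    · exact ⟨(D / 4 + 1).toNat, 2, by omega, by omega⟩
    · exact ⟨(D / 4 + 3).toNat, 3, by omega, by omega⟩
  obtain ⟨A, B, C, E, hdet, hprim, hfix⟩ := exists_fixed_of_heckeProd_eq_zero (by omega)
    (exists_heckeProd_eq_zero_of_aeval_minpoly (by omega)
      (heckeProd_eq_zero_of_hasDisc (by omega) h hu) hy rfl)
  obtain ⟨Δ', hΔ'⟩ := exists_hasDisc_of_quadratic σ.im_pos (x := C) (y := E - A) (z := -B)
    (by push_cast; linear_combination -hfix) (by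
      rintro ⟨rfl, hE, hB⟩
      have hE' : E = A := by linarith
      have hB' : B = 0 := by linarith
      subst hE' hB'
      have := hprim E dvd_rfl (by simp) (by simp) dvd_rfl
      simp at hdet
      rcases Int.isUnit_iff.1 this with rfl | rfl <;> norm_num at hdet <;> omega)
  obtain ⟨D', rfl⟩ : ∃ D, Δ' = -D := ⟨-Δ', by ring⟩
  have hneg' := hΔ'.neg σ.im_pos
  have hint : IsIntegral ℚ (klein τ) := h.isIntegral_klein.tower_top
  have r1 := normRel_of_conjugate h hΔ' hy
  have r2 := normRel_of_conjugate hΔ' h (by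
    rw [minpoly_eq_of_aeval_eq_zero hint hy]; exact minpoly.aeval ℚ _)
  rcases lt_trichotomy D D' with hlt | rfl | hlt
  · exact (not_normRel_of_lt (by omega) hlt h.mod_four hΔ'.mod_four r1 r2).elim
  · exact hΔ'
  · exact (not_normRel_of_lt (by omega) hlt hΔ'.mod_four h.mod_four r2 r1).elim

end

section

open UpperHalfPlane

/-- The action of a matrix of determinant one on roots of forms. -/
lemma quadratic_smul {σ τ : ℍ} {γ : Matrix.SpecialLinearGroup (Fin 2) ℤ} (hγ : γ • σ = τ)
    {a b c : ℤ} (h : (a : ℂ) * (σ : ℂ) ^ 2 + (b : ℂ) * σ + (c : ℂ) = 0) :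
    ((a * γ 1 1 ^ 2 - b * γ 1 1 * γ 1 0 + c * γ 1 0 ^ 2 : ℤ) : ℂ) * (τ : ℂ) ^ 2 +
      ((-2 * a * γ 1 1 * γ 0 1 + b * (γ 1 1 * γ 0 0 + γ 0 1 * γ 1 0) - 2 * c * γ 0 0 * γ 1 0 : ℤ) : ℂ)
        * τ + ((a * γ 0 1 ^ 2 - b * γ 0 1 * γ 0 0 + c * γ 0 0 ^ 2 : ℤ) : ℂ) = 0 := by
  have h1 := coe_smul_eq_div γ σ
  rw [hγ] at h1
  have hdet : γ 0 0 * γ 1 1 - γ 0 1 * γ 1 0 = 1 := by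
    have := γ.det_coe
    rwa [Matrix.det_fin_two] at this
  have hdetC : (γ 0 0 : ℂ) * γ 1 1 - γ 0 1 * γ 1 0 = 1 := by exact_mod_cast hdet
  have hne : (γ 1 0 : ℂ) * σ + γ 1 1 ≠ 0 := fun h => by
    obtain ⟨e1, e2⟩ := eq_zero_of_linear_eq_zero σ.im_pos.ne' h
    rw [e1, e2] at hdet
    simp at hdet
  generalize γ 0 0 = p at *
  generalize γ 0 1 = q at *
  generalize γ 1 0 = r at *
  generalize γ 1 1 = s at *
  push_cast
  have hm : (τ : ℂ) * ((r : ℂ) * (σ : ℂ) + s) = p * σ + q := by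
    rw [h1, div_mul_cancel₀ _ hne]
  have e1 : (s : ℂ) * τ - q = (σ : ℂ) * ((r : ℂ) * (σ : ℂ) + s)⁻¹ := by
    rw [eq_mul_inv_iff_mul_eq₀ hne]
    linear_combination s * hm + (σ : ℂ) * hdetC
  have e2 : (p : ℂ) - r * τ = ((r : ℂ) * (σ : ℂ) + s)⁻¹ := by
    refine eq_inv_of_mul_eq_one_left ?_
    linear_combination -r * hm + hdetC
  have e3 : (a : ℂ) * (s * τ - q) ^ 2 + b * (s * τ - q) * (p - r * τ) + c * (p - r * τ) ^ 2 = 0 := by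
    rw [e1, e2]
    linear_combination (((r : ℂ) * (σ : ℂ) + s)⁻¹) ^ 2 * h
  linear_combination e3

lemma HasDisc.smul {σ : ℍ} {Δ : ℤ} (h : HasDisc σ Δ) (γ : Matrix.SpecialLinearGroup (Fin 2) ℤ) :
    HasDisc (γ • σ : ℍ) Δ := by
  have hneg := h.neg σ.im_pos
  obtain ⟨a, b, c, ha, hg, h1, hΔ⟩ := h
  have h2 := quadratic_smul (γ := γ) rfl h1
  have hdet : γ 0 0 * γ 1 1 - γ 0 1 * γ 1 0 = 1 := by
    have := γ.det_coe
    rwa [Matrix.det_fin_two] at this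
  refine ⟨_, _, _, ?_, gcd_eq_one_of_isUnit fun k k1 k2 k3 => ?_, h2, ?_⟩
  · generalize γ 0 0 = p at *
    generalize γ 0 1 = q at *
    generalize γ 1 0 = r at *
    generalize γ 1 1 = s at *
    have e : 4 * a * (a * s ^ 2 - b * s * r + c * r ^ 2) = (2 * a * s - b * r) ^ 2 + -Δ * r ^ 2 := by
      rw [hΔ]; ring
    refine pos_of_mul_pos_right (a := 4 * a) ?_ (by omega)
    rw [e]
    rcases eq_or_ne r 0 with rfl | hr
    · have hs : s ≠ 0 := by rintro rfl; simp at hdet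
      have : (2 * a * s - b * 0) ≠ 0 := by
        rw [mul_zero, sub_zero]
        exact mul_ne_zero (by omega) hs
      have := sq_pos_of_ne_zero this
      simpa using this
    · have : 0 < -Δ := by omega
      positivity
  · generalize γ 0 0 = p at *
    generalize γ 0 1 = q at *
    generalize γ 1 0 = r at *
    generalize γ 1 1 = s at *
    set a' := a * s ^ 2 - b * s * r + c * r ^ 2 with ha'
    set b' := -2 * a * s * q + b * (s * p + q * r) - 2 * c * p * r with hb'
    set c' := a * q ^ 2 - b * q * p + c * p ^ 2 with hc'
    have hdet2 : (p * s - q * r) ^ 2 = 1 := by rw [hdet, one_pow]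
    have e1 : a = a' * p ^ 2 + b' * (p * r) + c' * r ^ 2 := by
      rw [ha', hb', hc']; linear_combination -a * hdet2
    have e2 : b = a' * (2 * p * q) + b' * (p * s + q * r) + c' * (2 * r * s) := by
      rw [ha', hb', hc']; linear_combination -b * hdet2
    have e3 : c = a' * q ^ 2 + b' * (q * s) + c' * s ^ 2 := by
      rw [ha', hb', hc']; linear_combination -c * hdet2
    refine isUnit_of_dvd_of_gcd_eq_one hg ?_ ?_ ?_
    · rw [e1]
      exact dvd_add (dvd_add (k1.mul_right _) (k2.mul_right _)) (k3.mul_right _)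
    · rw [e2]
      exact dvd_add (dvd_add (k1.mul_right _) (k2.mul_right _)) (k3.mul_right _)
    · rw [e3]
      exact dvd_add (dvd_add (k1.mul_right _) (k2.mul_right _)) (k3.mul_right _)
  · generalize γ 0 0 = p at *
    generalize γ 0 1 = q at *
    generalize γ 1 0 = r at *
    generalize γ 1 1 = s at *
    have hdet2 : (p * s - q * r) ^ 2 = 1 := by rw [hdet, one_pow]
    linear_combination hΔ - (b ^ 2 - 4 * a * c) * hdet2

lemma sqrtD_sq {Δ : ℤ} (h : Δ < 0) : sqrtD Δ ^ 2 = Δ := by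
  have h1 : (0 : ℝ) ≤ -(Δ : ℝ) := by
    have : (Δ : ℝ) < 0 := by exact_mod_cast h
    linarith
  rw [sqrtD, mul_pow, Complex.I_sq, ← Complex.ofReal_pow, Real.sq_sqrt h1]
  push_cast
  ring

lemma sqrtD_im_pos {Δ : ℤ} (h : Δ < 0) : 0 < (sqrtD Δ).im := by
  have h1 : (0 : ℝ) < -(Δ : ℝ) := by
    have : (Δ : ℝ) < 0 := by exact_mod_cast h
    linarith
  simpa [sqrtD] using h1

/-- The root in the upper half-plane of a form of discriminant `Δ`. -/
noncomputable def formRoot (Δ : ℤ) (a b : ℤ) (h : Δ < 0) (ha : 0 < a) : ℍ :=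
  ⟨(-(b : ℂ) + sqrtD Δ) / (2 * (a : ℂ)), by
    have h1 := sqrtD_im_pos h
    have h2 : (2 * (a : ℂ)) = ((2 * a : ℝ) : ℂ) := by push_cast; rfl
    have h3 : (0 : ℝ) < 2 * a := by
      have : (0 : ℝ) < a := by exact_mod_cast ha
      linarith
    rw [h2, Complex.div_ofReal_im]
    simpa using div_pos h1 h3⟩

lemma formRoot_quadratic {Δ a b c : ℤ} (h : Δ < 0) (ha : 0 < a) (hΔ : Δ = b ^ 2 - 4 * a * c) :
    (a : ℂ) * (formRoot Δ a b h ha : ℂ) ^ 2 + (b : ℂ) * (formRoot Δ a b h ha : ℂ) + (c : ℂ) = 0 := by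
  have h1 := sqrtD_sq h
  have h2 : (Δ : ℂ) = b ^ 2 - 4 * a * c := by rw [hΔ]; push_cast; ring
  have ha' : (a : ℂ) ≠ 0 := by exact_mod_cast ha.ne'
  change (a : ℂ) * ((-(b : ℂ) + sqrtD Δ) / (2 * (a : ℂ))) ^ 2 +
    (b : ℂ) * ((-(b : ℂ) + sqrtD Δ) / (2 * (a : ℂ))) + (c : ℂ) = 0
  field_simp
  linear_combination h1 + h2

lemma eq_formRoot {τ : ℍ} {Δ a b c : ℤ} (h : Δ < 0) (ha : 0 < a)
    (h1 : (a : ℂ) * (τ : ℂ) ^ 2 + (b : ℂ) * (τ : ℂ) + (c : ℂ) = 0) (hΔ : Δ = b ^ 2 - 4 * a * c) :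
    τ = formRoot Δ a b h ha := by
  have ha' : (a : ℂ) ≠ 0 := by exact_mod_cast ha.ne'
  have h2 : (Δ : ℂ) = b ^ 2 - 4 * a * c := by rw [hΔ]; push_cast; ring
  have h3 : (2 * (a : ℂ) * τ + b) ^ 2 = sqrtD Δ ^ 2 := by
    rw [sqrtD_sq h]
    linear_combination 4 * (a : ℂ) * h1 - h2
  refine UpperHalfPlane.ext ?_
  change (τ : ℂ) = (-(b : ℂ) + sqrtD Δ) / (2 * (a : ℂ))
  rcases sq_eq_sq_iff_eq_or_eq_neg.1 h3 with h4 | h4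
  · field_simp
    linear_combination h4
  · have h5 := congrArg Complex.im h4
    have h6 := sqrtD_im_pos h
    have h7 : (2 * (a : ℂ) * τ + b).im = 2 * a * (τ : ℂ).im := by simp
    rw [h7, Complex.neg_im] at h5
    have h8 : (0 : ℝ) < a := by exact_mod_cast ha
    have h9 : 0 < 2 * (a : ℝ) * (τ : ℂ).im := by
      have := τ.im_pos
      exact mul_pos (by linarith) this
    linarith

lemma hasDisc_formRoot {Δ a b c : ℤ} (h : Δ < 0) (ha : 0 < a) (hg : Int.gcd a (Int.gcd b c) = 1)
    (hΔ : Δ = b ^ 2 - 4 * a * c) : HasDisc (formRoot Δ a b h ha) Δ :=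
  ⟨a, b, c, ha, hg, formRoot_quadratic h ha hΔ, hΔ⟩

lemma Tset_pos {Δ : ℤ} (h : Δ < 0) {t : ℤ × ℤ × ℤ} (ht : t ∈ Tset Δ) : 0 < t.1 := by
  obtain ⟨-, hΔ, ht | ht⟩ := ht
  · omega
  · rcases (by omega : t.1 = 0 ∨ 0 < t.1) with h0 | h0
    · rw [h0] at hΔ
      have := sq_nonneg t.2.1
      omega
    · exact h0

lemma Tset_finite {Δ : ℤ} (h : Δ < 0) : (Tset Δ).Finite := by
  refine ((Set.finite_Icc (-(-Δ)) (-Δ)).prod ((Set.finite_Icc (-(-Δ)) (-Δ)).prod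
    (Set.finite_Icc (-(-Δ)) (-Δ)))).subset ?_
  rintro ⟨a, b, c⟩ ht
  have ha := Tset_pos h ht
  obtain ⟨-, hΔ, ht⟩ := ht
  simp only at ha hΔ ht
  have hb : -a ≤ b ∧ b ≤ a ∧ a ≤ c := by omega
  obtain ⟨h1, h2, h3⟩ := hb
  have h4 : c ≤ -Δ := by nlinarith
  simp only [Set.mem_prod, Set.mem_Icc]
  omega

lemma form_value_ge {a b c s r : ℤ} (ha : 0 < a) (h1 : -a ≤ b) (h2 : b ≤ a) (h3 : a ≤ c)
    (hr : r ≠ 0) : c ≤ a * s ^ 2 - b * s * r + c * r ^ 2 := by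
  have hr1 : 1 ≤ |r| := Int.one_le_abs hr
  have hb : |b| ≤ a := abs_le.2 ⟨h1, h2⟩
  have hprod : b * s * r ≤ a * (|s| * |r|) := by
    refine (le_abs_self _).trans ?_
    rw [abs_mul, abs_mul, mul_assoc]
    exact mul_le_mul_of_nonneg_right hb (by positivity)
  rw [← sq_abs s, ← sq_abs r]
  rcases eq_or_ne s 0 with rfl | hs
  · simp only [mul_zero, zero_mul, abs_zero]
    have e2 : 1 ≤ |r| ^ 2 := one_le_pow₀ hr1
    nlinarith [mul_nonneg (ha.le.trans h3) (sub_nonneg.2 e2)]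
  · have hs1 : 1 ≤ |s| := Int.one_le_abs hs
    have e1 : 1 ≤ |s| * |r| := by nlinarith
    have e2 : 1 ≤ |r| ^ 2 := by nlinarith
    nlinarith [mul_nonneg ha.le (sq_nonneg (|s| - |r|)),
      mul_nonneg (sub_nonneg.2 h3) (sub_nonneg.2 e2)]

/-- Distinct reduced forms have distinct values of `j`. -/
theorem injOn_klein_Tset {Δ : ℤ} (h : Δ < 0) :
    Set.InjOn (fun t : ℤ × ℤ × ℤ => klein ((-(t.2.1 : ℂ) + sqrtD Δ) / (2 * (t.1 : ℂ)))) (Tset Δ) := by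
  rintro ⟨a, b, c⟩ ht ⟨a', b', c'⟩ ht' heq
  have ha := Tset_pos h ht
  have ha' := Tset_pos h ht'
  obtain ⟨hg, hΔ, ht⟩ := ht
  obtain ⟨hg', hΔ', ht'⟩ := ht'
  simp only at ha ha' hg hg' hΔ hΔ' ht ht'
  obtain ⟨γ, hγ⟩ := exists_smul_eq_of_klein_eq (formRoot Δ a b h ha) (formRoot Δ a' b' h ha') heq
  have q1 := quadratic_smul hγ (formRoot_quadratic h ha hΔ)
  have q2 := formRoot_quadratic h ha' hΔ'
  have hdet : γ 0 0 * γ 1 1 - γ 0 1 * γ 1 0 = 1 := by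
    have := γ.det_coe
    rwa [Matrix.det_fin_two] at this
  obtain ⟨v, v1, v2, v3⟩ := exists_eq_mul_of_quadratic (formRoot Δ a' b' h ha').im_pos ha' hg' q2 q1
  generalize γ 0 0 = p at *
  generalize γ 0 1 = q at *
  generalize γ 1 0 = r at *
  generalize γ 1 1 = s at *
  have hdet2 : (p * s - q * r) ^ 2 = 1 := by rw [hdet, one_pow]
  have w1 : a = v * (a' * p ^ 2 + b' * (p * r) + c' * r ^ 2) := by
    linear_combination -a * hdet2 + p ^ 2 * v1 + p * r * v2 + r ^ 2 * v3
  have w2 : b = v * (a' * (2 * p * q) + b' * (p * s + q * r) + c' * (2 * r * s)) := by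
    linear_combination -b * hdet2 + 2 * p * q * v1 + (p * s + q * r) * v2 + 2 * r * s * v3
  have w3 : c = v * (a' * q ^ 2 + b' * (q * s) + c' * s ^ 2) := by
    linear_combination -c * hdet2 + q ^ 2 * v1 + q * s * v2 + s ^ 2 * v3
  have hvu : IsUnit v := isUnit_of_dvd_of_gcd_eq_one hg ⟨_, w1⟩ ⟨_, w2⟩ ⟨_, w3⟩
  have k1 : -a ≤ b ∧ b ≤ a ∧ a ≤ c := by omega
  have k2 : -a' ≤ b' ∧ b' ≤ a' ∧ a' ≤ c' := by omega
  obtain ⟨k11, k12, k13⟩ := k1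
  obtain ⟨k21, k22, k23⟩ := k2
  rcases eq_or_ne r 0 with rfl | hr
  · have hps : p * s = 1 := by linarith
    have hs2 : s ^ 2 = 1 := by
      rcases Int.isUnit_iff.1 (IsUnit.of_mul_eq_one_right p hps) with rfl | rfl <;> norm_num
    have e1 : a = v * a' := by
      rw [← v1, hs2]; ring
    have hv : v = 1 := by
      rcases Int.isUnit_iff.1 hvu with rfl | rfl
      · rfl
      · omega
    subst hv
    have e2 : a = a' := by linarith
    subst e2
    have e3 : b' = b - 2 * a * (s * q) := by linear_combination -v2 + b * hps
    have e4 : s * q = 0 := by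
      by_contra hne
      rcases lt_or_gt_of_ne hne with hlt | hlt
      · have : a ≤ a * -(s * q) := le_mul_of_one_le_right ha.le (by omega)
        rw [mul_neg] at this
        rw [mul_assoc] at e3
        omega
      · have : a ≤ a * (s * q) := le_mul_of_one_le_right ha.le (by omega)
        rw [mul_assoc] at e3
        omega
    have e5 : b' = b := by rw [e3, e4]; ring
    subst e5
    have e6 : c = c' := by
      have : 4 * a * c = 4 * a * c' := by linarith
      exact mul_left_cancel₀ (by omega) this
    rw [e6]
  · have g1 := form_value_ge (s := s) ha k11 k12 k13 hr
    have g2 := form_value_ge (s := p) ha' k21 k22 k23 (neg_ne_zero.2 hr)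
    have hv : v = 1 := by
      rcases Int.isUnit_iff.1 hvu with rfl | rfl
      · rfl
      · rw [v1] at g1; omega
    subst hv
    have e1 : c ≤ a' := by rw [v1] at g1; linarith
    have e2 : c' ≤ a := by linarith
    have : a = c := by omega
    have : a' = c' := by omega
    have haa : a = a' := by omega
    have hcc : c = c' := by omega
    subst haa hcc
    have hb : b ^ 2 = b' ^ 2 := by linarith
    have hbb : b = b' := by
      have hb0 : 0 ≤ b := by omega
      have hb0' : 0 ≤ b' := by omega
      exact (sq_eq_sq₀ hb0 hb0').1 hb
    rw [hbb]

/-- Every class of forms has a reduced representative. -/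
theorem HasDisc.exists_Tset {τ : ℍ} {Δ : ℤ} (h : HasDisc τ Δ) :
    ∃ t ∈ Tset Δ, klein ((-(t.2.1 : ℂ) + sqrtD Δ) / (2 * (t.1 : ℂ))) = klein τ := by
  have hneg := h.neg τ.im_pos
  obtain ⟨g, hg⟩ := ModularGroup.exists_smul_mem_fd τ
  rw [← klein_smul g]
  have h' := h.smul g
  generalize g • τ = z at *
  obtain ⟨a, b, c, ha, hgcd, h1, hΔ⟩ := h'
  have hz := eq_formRoot hneg ha h1 hΔ
  obtain ⟨hn, hre⟩ := hg
  have haR : (0 : ℝ) < a := by exact_mod_cast ha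
  have i1 : 2 * (a : ℝ) * (z : ℂ).re + b = 0 := by
    have h2 := congrArg Complex.im h1
    rw [sq] at h2
    simp at h2
    have h3 : (2 * (a : ℝ) * (z : ℂ).re + b) * (z : ℂ).im = 0 := by
      simp only [UpperHalfPlane.coe_re, UpperHalfPlane.coe_im]; linarith
    exact (mul_eq_zero.1 h3).resolve_right z.im_pos.ne'
  have i2 : (a : ℝ) * Complex.normSq z = c := by
    have h2 := congrArg Complex.re h1
    rw [sq] at h2
    simp at h2
    rw [Complex.normSq_apply]
    simp only [UpperHalfPlane.coe_re, UpperHalfPlane.coe_im] at *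
    linear_combination -h2 + z.re * i1
  have j1 : a ≤ c := by
    have : (a : ℝ) ≤ c := by rw [← i2]; exact le_mul_of_one_le_right haR.le hn
    exact_mod_cast this
  have hre' := abs_le.1 hre
  rw [← UpperHalfPlane.coe_re] at hre'
  have j2 : b ≤ a := by
    have : (b : ℝ) ≤ a := by nlinarith [hre'.1]
    exact_mod_cast this
  have j3 : -a ≤ b := by
    have : -(a : ℝ) ≤ b := by nlinarith [hre'.2]
    exact_mod_cast this
  by_cases c1 : b = -a
  · refine ⟨(a, a, c), ⟨?_, ?_, ?_⟩, ?_⟩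
    · subst c1
      refine gcd_eq_one_of_isUnit fun k k1 k2 k3 => isUnit_of_dvd_of_gcd_eq_one hgcd k1 ?_ k3
      exact (dvd_neg).2 k1
    · rw [hΔ, c1]; ring
    · simp only; omega
    · obtain ⟨γ, g1, g2, g3, g4⟩ := exists_specialLinearGroup 1 (-1) 0 1 (by norm_num)
      have e := quadratic_smul (γ := γ) rfl h1
      rw [g1, g2, g3, g4, c1] at e
      rw [← klein_smul γ z]
      have := eq_formRoot (τ := γ • z) (a := a) (b := a) (c := c) hneg ha (by
        rw [← e]; push_cast; ring) (by rw [hΔ, c1]; ring)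
      rw [this]
      rfl
  · by_cases c2 : a = c ∧ b < 0
    · obtain ⟨rfl, hb⟩ := c2
      refine ⟨(a, -b, a), ⟨?_, ?_, ?_⟩, ?_⟩
      · refine gcd_eq_one_of_isUnit fun k k1 k2 k3 => isUnit_of_dvd_of_gcd_eq_one hgcd k1 ?_ k3
        exact (dvd_neg).1 k2
      · rw [hΔ]; ring
      · exact Or.inr ⟨neg_nonneg.2 hb.le, neg_le.1 j3, rfl⟩
      · obtain ⟨γ, g1, g2, g3, g4⟩ := exists_specialLinearGroup 0 (-1) 1 0 (by norm_num)
        have e := quadratic_smul (γ := γ) rfl h1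
        rw [g1, g2, g3, g4] at e
        rw [← klein_smul γ z]
        have := eq_formRoot (τ := γ • z) (a := a) (b := -b) (c := a) hneg ha (by
          rw [← e]; push_cast; ring) (by rw [hΔ]; ring)
        rw [this]
        rfl
    · refine ⟨(a, b, c), ⟨hgcd, hΔ, ?_⟩, ?_⟩
      · simp only; omega
      · rw [hz]; rfl

end

section

open UpperHalfPlane Polynomial

lemma aeval_mem_of_congr {p : ℕ} (hp : p.Prime) {P : Ideal (integralClosure ℤ ℂ)} (hP : P.IsPrime)
    (hpP : (p : integralClosure ℤ ℂ) ∈ P) {h : ℤ[X]} {α β : integralClosure ℤ ℂ}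
    (hα : aeval α h = 0) (hc : (α ^ p - β) * (α - β ^ p) ∈ P) : aeval β h ∈ P := by
  have := Fact.mk hp
  have : IsDomain (integralClosure ℤ ℂ ⧸ P) := Ideal.Quotient.isDomain P
  have : CharP (integralClosure ℤ ℂ ⧸ P) p := charP_quotient_of_mem hP hp hpP
  have hfrob : ∀ x : integralClosure ℤ ℂ ⧸ P, aeval (x ^ p) h = aeval x h ^ p := fun x => by
    have := hom_eval₂ h (Int.castRingHom (integralClosure ℤ ℂ ⧸ P))
      (frobenius (integralClosure ℤ ℂ ⧸ P) p) x
    rw [RingHom.ext_int ((frobenius (integralClosure ℤ ℂ ⧸ P) p).comp (Int.castRingHom _))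
      (Int.castRingHom _), frobenius_def, frobenius_def] at this
    exact this.symm
  have hq : ∀ x : integralClosure ℤ ℂ,
      aeval (Ideal.Quotient.mk P x) h = Ideal.Quotient.mk P (aeval x h) := fun x =>
    aeval_algHom_apply (Ideal.Quotient.mkₐ ℤ P) x h
  rw [← Ideal.Quotient.eq_zero_iff_mem, ← hq]
  have hα' : aeval (Ideal.Quotient.mk P α) h = 0 := by rw [hq, hα, map_zero]
  rcases hP.mem_or_mem hc with h1 | h1
  · have h2 := Ideal.Quotient.eq.2 h1
    rw [← h2, map_pow, hfrob, hα', zero_pow hp.ne_zero]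
  · have h2 := Ideal.Quotient.eq.2 h1
    rw [h2, map_pow, hfrob] at hα'
    exact eq_zero_of_pow_eq_zero hα'

lemma exists_intCast_eq_mul {y : integralClosure ℤ ℂ} (hy : y ≠ 0) :
    ∃ N : ℤ, N ≠ 0 ∧ ∃ z : integralClosure ℤ ℂ, (N : integralClosure ℤ ℂ) = y * z := by
  have h := Ideal.comap_ne_bot_of_integral_mem (R := ℤ) hy
    (Ideal.mem_span_singleton_self y) (Algebra.IsIntegral.isIntegral y)
  obtain ⟨N, hN, hN0⟩ := Submodule.exists_mem_ne_zero_of_ne_bot h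
  exact ⟨N, hN0, Ideal.mem_span_singleton.1 hN⟩

lemma exists_isPrime_natCast_mem {p : ℕ} (hp : p.Prime) :
    ∃ P : Ideal (integralClosure ℤ ℂ), P.IsPrime ∧ (p : integralClosure ℤ ℂ) ∈ P := by
  have hprime : (Ideal.span {(p : ℤ)}).IsPrime :=
    (Ideal.span_singleton_prime (by exact_mod_cast hp.ne_zero)).2 (Nat.prime_iff_prime_int.1 hp)
  obtain ⟨P, -, hP, hc⟩ := Ideal.exists_ideal_over_prime_of_isIntegral (Ideal.span {(p : ℤ)})
    (⊥ : Ideal (integralClosure ℤ ℂ)) (by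
      rw [Ideal.comap_bot_of_injective _ (FaithfulSMul.algebraMap_injective ℤ _)]
      exact bot_le)
  refine ⟨P, hP, ?_⟩
  have : (p : ℤ) ∈ P.comap (algebraMap ℤ (integralClosure ℤ ℂ)) := by
    rw [hc]; exact Ideal.mem_span_singleton_self _
  simpa using this

/-- For a fixed polynomial the nonzero values at singular moduli of discriminant `Δ` divide a
common nonzero integer. -/
lemma exists_common_multiple {Δ : ℤ} (hΔ : Δ < 0) (h : ℤ[X]) :
    ∃ N : ℤ, N ≠ 0 ∧ ∀ σ : ℍ, HasDisc σ Δ → ∀ y : integralClosure ℤ ℂ, klein σ = y →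
      aeval y h = 0 ∨ ∃ z : integralClosure ℤ ℂ, (N : integralClosure ℤ ℂ) = aeval y h * z := by
  have key : ∀ x : ℂ, ∃ N : ℤ, N ≠ 0 ∧ ∀ y : integralClosure ℤ ℂ, x = y →
      aeval y h = 0 ∨ ∃ z : integralClosure ℤ ℂ, (N : integralClosure ℤ ℂ) = aeval y h * z := by
    intro x
    by_cases hx : ∃ y : integralClosure ℤ ℂ, x = y ∧ aeval y h ≠ 0
    · obtain ⟨y, hy, hne⟩ := hx
      obtain ⟨N, hN, z, hz⟩ := exists_intCast_eq_mul hne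
      refine ⟨N, hN, fun y' hy' => ?_⟩
      obtain rfl : y = y' := Subtype.ext (hy.symm.trans hy')
      exact Or.inr ⟨z, hz⟩
    · push Not at hx
      exact ⟨1, one_ne_zero, fun y hy => Or.inl (hx y hy)⟩
  choose N hN hN' using key
  refine ⟨∏ t ∈ (Tset_finite hΔ).toFinset, N (klein ((-(t.2.1 : ℂ) + sqrtD Δ) / (2 * (t.1 : ℂ)))),
    Finset.prod_ne_zero_iff.2 fun t _ => hN _, fun σ hσ y hy => ?_⟩
  obtain ⟨t, ht, he⟩ := hσ.exists_Tset
  rcases hN' (klein ((-(t.2.1 : ℂ) + sqrtD Δ) / (2 * (t.1 : ℂ)))) y (he.trans hy) with h0 | ⟨z, hz⟩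
  · exact Or.inl h0
  · obtain ⟨w, hw⟩ := Finset.dvd_prod_of_mem
      (fun t : ℤ × ℤ × ℤ => N (klein ((-(t.2.1 : ℂ) + sqrtD Δ) / (2 * (t.1 : ℂ)))))
      ((Tset_finite hΔ).mem_toFinset.2 ht)
    refine Or.inr ⟨z * w, ?_⟩
    rw [hw, Int.cast_mul, hz, mul_assoc]

lemma prime_dvd_prod_iff_mem {S : Finset ℕ} (hS : ∀ q ∈ S, q.Prime) {p : ℕ} (hp : p.Prime) :
    p ∣ ∏ q ∈ S, q ↔ p ∈ S := by
  rw [hp.prime.dvd_finsetProd_iff]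
  constructor
  · rintro ⟨q, hq, hpq⟩
    rwa [(Nat.prime_dvd_prime_iff_eq hp (hS q hq)).1 hpq]
  · exact fun h => ⟨p, h, dvd_rfl⟩

/-- A primitive form properly represents an integer coprime to a given one. -/
lemma exists_isCoprime_form_value {a b c N : ℤ} (hg : Int.gcd a (Int.gcd b c) = 1) (hN : N ≠ 0) :
    ∃ x y : ℤ, IsCoprime x y ∧ IsCoprime (a * x ^ 2 + b * x * y + c * y ^ 2) N := by
  classical
  set S : Finset ℕ := N.natAbs.primeFactors.filter fun p => (p : ℤ) ∣ a ∧ ¬ (p : ℤ) ∣ c with hS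
  set T : Finset ℕ := N.natAbs.primeFactors.filter fun p => ¬ (p : ℤ) ∣ a with hT
  have hSp : ∀ q ∈ S, q.Prime := fun q hq => Nat.prime_of_mem_primeFactors (Finset.mem_filter.1 hq).1
  have hTp : ∀ q ∈ T, q.Prime := fun q hq => Nat.prime_of_mem_primeFactors (Finset.mem_filter.1 hq).1
  refine ⟨((∏ q ∈ S, q : ℕ) : ℤ), ((∏ q ∈ T, q : ℕ) : ℤ), ?_, ?_⟩
  · refine Nat.isCoprime_iff_coprime.2 (Nat.coprime_of_dvd fun p hp h1 h2 => ?_)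
    rw [prime_dvd_prod_iff_mem hSp hp] at h1
    rw [prime_dvd_prod_iff_mem hTp hp] at h2
    exact (Finset.mem_filter.1 h2).2 (Finset.mem_filter.1 h1).2.1
  · rw [Int.isCoprime_iff_gcd_eq_one]
    refine Nat.coprime_of_dvd fun p hp h1 h2 => ?_
    rw [← Int.natCast_dvd] at h1
    have hpN : p ∈ N.natAbs.primeFactors :=
      Nat.mem_primeFactors.2 ⟨hp, h2, Int.natAbs_ne_zero.2 hN⟩
    have hpZ := Nat.prime_iff_prime_int.1 hp
    have hx : (p : ℤ) ∣ ((∏ q ∈ S, q : ℕ) : ℤ) ↔ (p : ℤ) ∣ a ∧ ¬ (p : ℤ) ∣ c := by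
      rw [Int.natCast_dvd_natCast, prime_dvd_prod_iff_mem hSp hp, hS, Finset.mem_filter]
      exact and_iff_right hpN
    have hy : (p : ℤ) ∣ ((∏ q ∈ T, q : ℕ) : ℤ) ↔ ¬ (p : ℤ) ∣ a := by
      rw [Int.natCast_dvd_natCast, prime_dvd_prod_iff_mem hTp hp, hT, Finset.mem_filter]
      exact and_iff_right hpN
    generalize ((∏ q ∈ S, q : ℕ) : ℤ) = x at *
    generalize ((∏ q ∈ T, q : ℕ) : ℤ) = y at *
    by_cases ha : (p : ℤ) ∣ a
    · have hy' : ¬ (p : ℤ) ∣ y := fun h => hy.1 h ha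
      by_cases hc : (p : ℤ) ∣ c
      · have hx' : ¬ (p : ℤ) ∣ x := fun h => (hx.1 h).2 hc
        have h3 : (p : ℤ) ∣ b * x * y := by
          have h4 := dvd_sub (dvd_sub h1 (ha.mul_right (x ^ 2))) (hc.mul_right (y ^ 2))
          rwa [show a * x ^ 2 + b * x * y + c * y ^ 2 - a * x ^ 2 - c * y ^ 2 = b * x * y by ring]
            at h4
        have hb := (hpZ.dvd_or_dvd ((hpZ.dvd_or_dvd h3).resolve_right hy')).resolve_right hx'
        exact hpZ.not_isUnit (isUnit_of_dvd_of_gcd_eq_one hg ha hb hc)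
      · have hx' := hx.2 ⟨ha, hc⟩
        have h3 : (p : ℤ) ∣ c * y ^ 2 := by
          have h4 := dvd_sub h1 (hx'.mul_right (a * x + b * y))
          rwa [show a * x ^ 2 + b * x * y + c * y ^ 2 - x * (a * x + b * y) = c * y ^ 2 by ring] at h4
        exact hy' (hpZ.dvd_of_dvd_pow ((hpZ.dvd_or_dvd h3).resolve_left hc))
    · have hy' := hy.2 ha
      have hx' : ¬ (p : ℤ) ∣ x := fun h => ha (hx.1 h).1
      have h3 : (p : ℤ) ∣ a * x ^ 2 := by
        have h4 := dvd_sub h1 (hy'.mul_right (b * x + c * y))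
        rwa [show a * x ^ 2 + b * x * y + c * y ^ 2 - y * (b * x + c * y) = a * x ^ 2 by ring] at h4
      exact hx' (hpZ.dvd_of_dvd_pow ((hpZ.dvd_or_dvd h3).resolve_left ha))

/-- Every singular modulus comes from a form whose leading coefficient is coprime to `N`. -/
lemma HasDisc.exists_coprime_form {τ : ℍ} {Δ N : ℤ} (h : HasDisc τ Δ) (hN : N ≠ 0) :
    ∃ (a b c : ℤ) (hΔ : Δ < 0) (ha : 0 < a), Δ = b ^ 2 - 4 * a * c ∧ IsCoprime a N ∧
      klein (formRoot Δ a b hΔ ha) = klein τ := by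
  have hneg := h.neg τ.im_pos
  obtain ⟨a, b, c, ha, hg, h1, hΔ⟩ := id h
  obtain ⟨x, y, ⟨u, v, huv⟩, hco⟩ := exists_isCoprime_form_value hg hN
  obtain ⟨γ, g1, g2, g3, g4⟩ := exists_specialLinearGroup u v (-y) x (by linarith)
  have q1 := quadratic_smul (γ := γ) rfl h1
  obtain ⟨a', b', c', ha', hg', q2, hΔ'⟩ := h.smul γ
  obtain ⟨w, w1, -, -⟩ := exists_eq_mul_of_quadratic (γ • τ).im_pos ha' hg' q2 q1
  rw [g3, g4] at w1
  refine ⟨a', b', c', hneg, ha', hΔ', ?_, ?_⟩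
  · have : a * x ^ 2 + b * x * y + c * y ^ 2 = w * a' := by rw [← w1]; ring
    rw [this] at hco
    exact hco.of_mul_left_right
  · rw [← eq_formRoot hneg ha' q2 hΔ', klein_smul]

lemma klein_formRoot_one_eq {Δ b b' c c' : ℤ} (h : Δ < 0) (h1 : Δ = b ^ 2 - 4 * c)
    (h2 : Δ = b' ^ 2 - 4 * c') :
    klein (formRoot Δ 1 b h one_pos) = klein (formRoot Δ 1 b' h one_pos) := by
  obtain ⟨k, hk⟩ : ∃ k, b = b' + 2 * k := by
    have h3 : Even (b ^ 2 - b' ^ 2) := ⟨2 * (c - c'), by linarith⟩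
    have h4 : Even (b - b') := by
      rw [Int.even_sub] at h3 ⊢
      simpa [Int.even_pow] using h3
    obtain ⟨k, hk⟩ := h4
    exact ⟨k, by linarith⟩
  obtain ⟨γ, g1, g2, g3, g4⟩ := exists_specialLinearGroup 1 k 0 1 (by norm_num)
  rw [← klein_smul γ, coe_smul_eq_div, g1, g2, g3, g4]
  congr 1
  change (((1 : ℤ) : ℂ) * ((-(b : ℂ) + sqrtD Δ) / (2 * ((1 : ℤ) : ℂ))) + k) /
    (((0 : ℤ) : ℂ) * _ + ((1 : ℤ) : ℂ)) = (-(b' : ℂ) + sqrtD Δ) / (2 * ((1 : ℤ) : ℂ))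
  rw [hk]
  push_cast
  ring

/-- Walking along prime isogenies of degree coprime to a suitable integer stays among the roots of
an integer polynomial. -/
lemma aeval_klein_formRoot_eq_zero {Δ : ℤ} (hΔ : Δ < 0) {h : ℤ[X]} {N : ℤ}
    (hN : ∀ σ : ℍ, HasDisc σ Δ → ∀ y : integralClosure ℤ ℂ, klein σ = y →
      aeval y h = 0 ∨ ∃ z : integralClosure ℤ ℂ, (N : integralClosure ℤ ℂ) = aeval y h * z)
    {a b c : ℤ} (hform : Δ = b ^ 2 - 4 * a * c) (hco : IsCoprime a (N * Δ))
    (hbase : aeval (klein (formRoot Δ 1 b hΔ one_pos)) h = 0) (n : ℕ) :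
    ∀ hn : 0 < (n : ℤ), (n : ℤ) ∣ a → aeval (klein (formRoot Δ n b hΔ hn)) h = 0 := by
  have hdisc : ∀ (n : ℤ) (hn : 0 < n), n ∣ a → HasDisc (formRoot Δ n b hΔ hn) Δ := by
    rintro n hn ⟨m, hm⟩
    refine hasDisc_formRoot (c := m * c) hΔ hn (gcd_eq_one_of_isUnit fun k k1 k2 k3 => ?_) (by
      rw [hform, hm]; ring)
    have hka : k ∣ a := k1.trans ⟨m, hm⟩
    have hkΔ : k ∣ Δ := by
      rw [hform]
      exact dvd_sub (k2.pow two_ne_zero) ((hka.mul_left 4).mul_right c)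
    exact hco.of_mul_right_right.isUnit_of_dvd' hka hkΔ
  have hcast : ∀ x : integralClosure ℤ ℂ, aeval (x : ℂ) h = (aeval x h : integralClosure ℤ ℂ) :=
    fun x => aeval_algebraMap_apply ℂ x h
  induction n using induction_on_primes with
  | zero => intro hn; exact absurd hn (by simp)
  | one => intro _ _; exact_mod_cast hbase
  | prime_mul p n hp ih =>
    intro hpn hdvd
    have hn : 0 < (n : ℤ) := by
      rcases Nat.eq_zero_or_pos n with rfl | h0
      · simp at hpn
      · exact_mod_cast h0
    have hna : (n : ℤ) ∣ a := (Dvd.intro_left (p : ℤ) (by push_cast; ring)).trans hdvd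
    have hpa : (p : ℤ) ∣ a := (Dvd.intro (n : ℤ) (by push_cast; ring)).trans hdvd
    have hα := ih hn hna
    have d1 := hdisc _ hn hna
    have d2 := hdisc _ hpn hdvd
    obtain ⟨α, hαe⟩ : ∃ α : integralClosure ℤ ℂ, klein (formRoot Δ n b hΔ hn) = α :=
      ⟨⟨_, d1.isIntegral_klein⟩, rfl⟩
    obtain ⟨β, hβe⟩ : ∃ β : integralClosure ℤ ℂ, klein (formRoot Δ (p * n : ℕ) b hΔ hpn) = β :=
      ⟨⟨_, d2.isIntegral_klein⟩, rfl⟩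
    have hat : kleinAt (p, 0, 1) (formRoot Δ (p * n : ℕ) b hΔ hpn) = α := by
      rw [← hαe, kleinAt]
      congr 1
      change ((p : ℂ) * ((-(b : ℂ) + sqrtD Δ) / (2 * (((p * n : ℕ) : ℤ) : ℂ))) + ((0 : ℕ) : ℂ)) /
        ((1 : ℕ) : ℂ) = (-(b : ℂ) + sqrtD Δ) / (2 * ((n : ℤ) : ℂ))
      have hp0 : (p : ℂ) ≠ 0 := by exact_mod_cast hp.ne_zero
      have hn0 : (n : ℂ) ≠ 0 := by
        have := hn.ne'
        exact_mod_cast this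
      push_cast
      field_simp
      ring
    rw [hαe, hcast] at hα
    have hα0 : aeval α h = 0 := Subtype.ext hα
    rw [hβe, hcast]
    rcases hN _ d2 β hβe with h0 | ⟨z, hz⟩
    · rw [h0]; rfl
    · exfalso
      obtain ⟨P, hP, hpP⟩ := exists_isPrime_natCast_mem hp
      have hmem := aeval_mem_of_congr hp hP hpP hα0 (kronecker_congruence hp P hP hpP
        (t := (p, 0, 1)) (by rw [mem_heckeReps hp.pos]; simp) hat hβe)
      obtain ⟨u, v, huv⟩ := hco.of_mul_right_left.of_isCoprime_of_dvd_left hpa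
      have hone : (1 : integralClosure ℤ ℂ) = u * p + v * N := by exact_mod_cast huv.symm
      refine hP.ne_top ((Ideal.eq_top_iff_one P).2 ?_)
      rw [hone, hz]
      exact P.add_mem (P.mul_mem_left _ hpP) (P.mul_mem_left _ (P.mul_mem_right _ hmem))

/-- Singular moduli of equal discriminant are conjugate over `ℚ`. -/
theorem HasDisc.minpoly_klein_eq {σ τ : ℍ} {Δ : ℤ} (hσ : HasDisc σ Δ) (hτ : HasDisc τ Δ) :
    minpoly ℚ (klein σ) = minpoly ℚ (klein τ) := by
  have hneg := hσ.neg σ.im_pos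
  obtain ⟨b₀, c₀, hb₀⟩ : ∃ b c : ℤ, Δ = b ^ 2 - 4 * c := by
    obtain ⟨a, b, c, -, -, -, hΔ⟩ := hσ
    exact ⟨b, a * c, by rw [hΔ]; ring⟩
  have hbase : HasDisc (formRoot Δ 1 b₀ hneg one_pos) Δ :=
    hasDisc_formRoot (c := c₀) hneg one_pos (by simp) (by rw [hb₀]; ring)
  have hint := hbase.isIntegral_klein
  set x := klein (formRoot Δ 1 b₀ hneg one_pos) with hx
  suffices key : ∀ τ : ℍ, HasDisc τ Δ → minpoly ℚ (klein τ) = minpoly ℚ x by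
    rw [key σ hσ, key τ hτ]
  intro τ hτ
  have hintQ : IsIntegral ℚ x := hint.tower_top
  refine minpoly_eq_of_aeval_eq_zero hintQ ?_
  rw [minpoly.isIntegrallyClosed_eq_field_fractions' ℚ hint, aeval_map_algebraMap]
  obtain ⟨N, hN0, hN⟩ := exists_common_multiple hneg (minpoly ℤ x)
  obtain ⟨a, b, c, _, ha, hΔ, hco, hk⟩ := hτ.exists_coprime_form (mul_ne_zero hN0 hneg.ne)
  have h1 : aeval (klein (formRoot Δ 1 b hneg one_pos)) (minpoly ℤ x) = 0 := by
    rw [klein_formRoot_one_eq (c := a * c) hneg (by rw [hΔ]; ring) hb₀]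
    exact minpoly.aeval ℤ x
  lift a to ℕ using ha.le
  rw [← hk]
  exact aeval_klein_formRoot_eq_zero hneg hN hΔ hco h1 a ha dvd_rfl

end

theorem conjugates_of_singular_modulus
    (x : ℂ) (Δ : ℤ) (hx : IsSingularModulus x Δ) :
    {z : ℂ | Polynomial.aeval z (minpoly ℚ x) = 0} =
      (fun t : ℤ × ℤ × ℤ => klein ((-(t.2.1 : ℂ) + sqrtD Δ) / (2 * (t.1 : ℂ)))) '' Tset Δ ∧
    Set.InjOn (fun t : ℤ × ℤ × ℤ => klein ((-(t.2.1 : ℂ) + sqrtD Δ) / (2 * (t.1 : ℂ))))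
      (Tset Δ) ∧
    (minpoly ℚ x).natDegree = (Tset Δ).ncard := by
  obtain ⟨τ', hτ', hdisc', rfl⟩ := hx
  obtain ⟨τ, rfl⟩ : ∃ τ : UpperHalfPlane, (τ : ℂ) = τ' := ⟨⟨τ', hτ'⟩, rfl⟩
  have hdisc : HasDisc τ Δ := hdisc'
  have hneg := hdisc.neg τ.im_pos
  have hint : IsIntegral ℚ (klein τ) := hdisc.isIntegral_klein.tower_top
  have hroots : {z : ℂ | Polynomial.aeval z (minpoly ℚ (klein τ)) = 0} =
      (fun t : ℤ × ℤ × ℤ => klein ((-(t.2.1 : ℂ) + sqrtD Δ) / (2 * (t.1 : ℂ)))) '' Tset Δ := by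
    ext z
    constructor
    · intro hz
      obtain ⟨σ, rfl, hσ⟩ := exists_hasDisc_of_conjugate hdisc hz
      exact hσ.exists_Tset
    · rintro ⟨⟨a, b, c⟩, ht, rfl⟩
      have hd := hasDisc_formRoot hneg (Tset_pos hneg ht) ht.1 ht.2.1
      rw [Set.mem_ofPred_eq, HasDisc.minpoly_klein_eq hdisc hd]
      exact minpoly.aeval ℚ (klein (formRoot Δ a b hneg (Tset_pos hneg ht)))
  refine ⟨hroots, injOn_klein_Tset hneg, ?_⟩
  have hset : {z : ℂ | Polynomial.aeval z (minpoly ℚ (klein τ)) = 0} =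
      (minpoly ℚ (klein τ)).rootSet ℂ := by
    ext z
    rw [Polynomial.mem_rootSet]
    exact (and_iff_right (minpoly.ne_zero hint)).symm
  rw [← (injOn_klein_Tset hneg).ncard_image, ← hroots, hset, ← Nat.card_coe_set_eq,
    Nat.card_eq_fintype_card]
  exact (Polynomial.card_rootSet_eq_natDegree (minpoly.irreducible hint).separable
    (IsAlgClosed.splits _)).symm
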